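/- arXiv:math/0702446 — 4 statements merged into one kernel-verified Lean document; each statement's English description precedes it below -/
import Mathlib

section
/- The Bernstein transform f of the fixed point measure μ is differentiable on (0,∞) with f'(s) = ∫₀¹ (−log t) t^s/(1 − t) dμ(t), and it satisfies lim_{s→∞} f(s)/√(2s) = 1 and lim_{s→∞} f'(s)·√(2s) = 1. -/
open MeasureTheory Set Filter

/-- The fixed point sequence. -/
noncomputable def fpSeq : ℕ → ℝ
  | 0 => 1
  | n + 1 => (-1 + Real.sqrt (1 + 4 * fpSeq n ^ 2)) / (2 * fpSeq n)

/-- The integrand `(1 - t^s)/(1 - t)`, extended continuously by the value `s` at `t = 1`. -/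
noncomputable def bernKernelReal (s : ℝ) (t : ℝ) : ℝ :=
  if t = 1 then s else (1 - t ^ s) / (1 - t)

/-- The Bernstein transform of `μ`, restricted to real arguments. -/
noncomputable def bernTransformReal (μ : Measure ℝ) (s : ℝ) : ℝ :=
  ∫ t in Set.Icc (0:ℝ) 1, bernKernelReal s t ∂μ

theorem fpSeq_pos (n : ℕ) : 0 < fpSeq n := by
  induction n with
  | zero => simp [fpSeq]
  | succ n ih =>
    have h : 1 < Real.sqrt (1 + 4 * fpSeq n ^ 2) := by
      rw [Real.lt_sqrt zero_le_one]; nlinarith [pow_pos ih 2]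
    rw [fpSeq]
    exact div_pos (by linarith) (by linarith)

theorem fpSeq_succ_quadratic (n : ℕ) :
    fpSeq n * fpSeq (n + 1) ^ 2 + fpSeq (n + 1) = fpSeq n := by
  have hp := fpSeq_pos n
  have hs : Real.sqrt (1 + 4 * fpSeq n ^ 2) ^ 2 = 1 + 4 * fpSeq n ^ 2 :=
    Real.sq_sqrt (by positivity)
  rw [fpSeq]
  set r := Real.sqrt (1 + 4 * fpSeq n ^ 2)
  field_simp
  linear_combination hs

theorem fpSeq_le_one (n : ℕ) : fpSeq n ≤ 1 := by
  induction n with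
  | zero => simp [fpSeq]
  | succ n ih =>
    nlinarith [fpSeq_succ_quadratic n, mul_nonneg (fpSeq_pos n).le (sq_nonneg (fpSeq (n + 1)))]

/-- Partial sums of the fixed point sequence. -/
noncomputable def fpSum (n : ℕ) : ℝ := ∑ k ∈ Finset.range (n + 1), fpSeq k

theorem fpSum_succ (n : ℕ) : fpSum (n + 1) = fpSum n + fpSeq (n + 1) :=
  Finset.sum_range_succ _ _

theorem fpSum_mul_fpSeq (n : ℕ) : fpSum n * fpSeq n = 1 := by
  induction n with
  | zero => simp [fpSum, fpSeq]
  | succ n ih =>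
    have hq := fpSeq_succ_quadratic n
    rw [fpSum_succ]
    linear_combination (1 - fpSeq (n + 1) ^ 2) * ih + fpSum n * hq

theorem fpSum_pos (n : ℕ) : 0 < fpSum n :=
  Finset.sum_pos (fun k _ => fpSeq_pos k) (by simp)

theorem fpSum_sq_succ (n : ℕ) :
    fpSum (n + 1) ^ 2 = fpSum n ^ 2 + 2 - fpSeq (n + 1) ^ 2 := by
  have h := fpSum_mul_fpSeq (n + 1)
  rw [fpSum_succ] at h ⊢
  linear_combination 2 * h

theorem fpSum_sq_le (n : ℕ) : fpSum n ^ 2 ≤ 2 * n + 1 := by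
  induction n with
  | zero => simp [fpSum, fpSeq]
  | succ n ih =>
    rw [fpSum_sq_succ]; push_cast; nlinarith [sq_nonneg (fpSeq (n + 1))]

theorem le_fpSum_sq_add (n : ℕ) : (2 * n + 1 : ℝ) ≤ fpSum n ^ 2 + fpSum n := by
  induction n with
  | zero => simp [fpSum, fpSeq]
  | succ n ih =>
    rw [fpSum_sq_succ, fpSum_succ]; push_cast
    nlinarith [fpSeq_pos (n + 1), fpSeq_le_one (n + 1)]

theorem fpSum_le_sqrt (n : ℕ) : fpSum n ≤ Real.sqrt (2 * n + 1) :=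
  Real.le_sqrt_of_sq_le (fpSum_sq_le n)

theorem sqrt_sub_one_le_fpSum (n : ℕ) : Real.sqrt (2 * n + 1) - 1 ≤ fpSum n := by
  rw [sub_le_iff_le_add]
  refine Real.sqrt_le_iff.2 ⟨by linarith [fpSum_pos n], ?_⟩
  nlinarith [le_fpSum_sq_add n, fpSum_pos n]

theorem fpSeq_eq_inv (n : ℕ) : fpSeq n = (fpSum n)⁻¹ :=
  eq_inv_of_mul_eq_one_right (fpSum_mul_fpSeq n)

theorem tendsto_sqrt_two_mul_add_div (c : ℝ) :
    Tendsto (fun s : ℝ => Real.sqrt (2 * s + c) / Real.sqrt (2 * s)) atTop (nhds 1) := by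
  have h : Tendsto (fun s : ℝ => Real.sqrt (1 + c / 2 * s⁻¹)) atTop (nhds 1) := by
    have := ((tendsto_inv_atTop_zero (𝕜 := ℝ)).const_mul (c / 2)).const_add 1
    simpa using this.sqrt
  refine h.congr' ?_
  filter_upwards [eventually_gt_atTop 0] with s hs
  rw [← Real.sqrt_div' _ (by positivity)]
  congr 1
  field_simp

theorem tendsto_sqrt_two_mul_add_sub_div (c d : ℝ) :
    Tendsto (fun s : ℝ => (Real.sqrt (2 * s + c) - d) / Real.sqrt (2 * s)) atTop (nhds 1) := by
  have h : Tendsto (fun s : ℝ => d / Real.sqrt (2 * s)) atTop (nhds 0) :=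
    tendsto_const_nhds.div_atTop
      (Real.tendsto_sqrt_atTop.comp (tendsto_id.const_mul_atTop two_pos))
  simpa [sub_div] using (tendsto_sqrt_two_mul_add_div c).sub h

theorem tendsto_fpSeq : Tendsto fpSeq atTop (nhds 0) := by
  have h : Tendsto fpSum atTop atTop := by
    refine tendsto_atTop_mono sqrt_sub_one_le_fpSum ?_
    refine tendsto_atTop_add_const_right _ _ (Real.tendsto_sqrt_atTop.comp ?_)
    exact tendsto_atTop_add_const_right _ _
      (tendsto_natCast_atTop_atTop.const_mul_atTop two_pos)
  exact h.inv_tendsto_atTop.congr fun n => (fpSeq_eq_inv n).symm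

theorem bernKernelReal_of_lt {s t : ℝ} (ht : t < 1) :
    bernKernelReal s t = (1 - t ^ s) / (1 - t) := if_neg ht.ne

theorem bernKernelReal_natCast {t : ℝ} (ht : t < 1) (n : ℕ) :
    bernKernelReal n t = ∑ k ∈ Finset.range n, t ^ k := by
  rw [bernKernelReal_of_lt ht, Real.rpow_natCast, geom_sum_eq ht.ne, ← neg_div_neg_eq]
  simp

theorem bernKernelReal_mono {s r t : ℝ} (ht : t ∈ Ioo (0 : ℝ) 1) (h : s ≤ r) :
    bernKernelReal s t ≤ bernKernelReal r t := by
  rw [bernKernelReal_of_lt ht.2, bernKernelReal_of_lt ht.2]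
  have := Real.rpow_le_rpow_of_exponent_ge ht.1 ht.2.le h
  have := ht.2
  gcongr

theorem measurable_bernKernelReal (s : ℝ) : Measurable (bernKernelReal s) := by
  unfold bernKernelReal
  exact Measurable.ite (measurableSet_singleton 1) measurable_const (by fun_prop)

/-- The derivative in `s` of `bernKernelReal s t` for `t ∈ (0, 1)`. -/
noncomputable def bernKernelDeriv (s t : ℝ) : ℝ := (-Real.log t) * t ^ s / (1 - t)

theorem measurable_bernKernelDeriv (s : ℝ) : Measurable (bernKernelDeriv s) := by
  unfold bernKernelDeriv
  fun_prop

theorem hasDerivAt_bernKernelReal {t : ℝ} (ht : t ∈ Ioo (0 : ℝ) 1) (s : ℝ) :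
    HasDerivAt (fun x => bernKernelReal x t) (bernKernelDeriv s t) s := by
  have heq : (fun x => bernKernelReal x t) = fun x => (1 - t ^ x) / (1 - t) :=
    funext fun _ => bernKernelReal_of_lt ht.2
  rw [heq]
  have h := (((hasDerivAt_id s).const_rpow ht.1).const_sub 1).div_const (1 - t)
  exact h.congr_deriv (by simp [bernKernelDeriv])

theorem rpow_le_bernKernelDeriv {t : ℝ} (ht : t ∈ Ioo (0 : ℝ) 1) (s : ℝ) :
    t ^ s ≤ bernKernelDeriv s t := by
  have h1 := Real.log_le_sub_one_of_pos ht.1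
  rw [bernKernelDeriv, le_div_iff₀ (by linarith [ht.2]), mul_comm]
  exact mul_le_mul_of_nonneg_right (by linarith) (Real.rpow_nonneg ht.1.le s)

theorem bernKernelDeriv_le_rpow {t : ℝ} (ht : t ∈ Ioo (0 : ℝ) 1) (s : ℝ) :
    bernKernelDeriv s t ≤ t ^ (s - 1) := by
  have h1 := Real.one_sub_inv_le_log_of_pos ht.1
  rw [bernKernelDeriv, div_le_iff₀ (by linarith [ht.2]), Real.rpow_sub_one ht.1.ne']
  have h2 : t ^ s / t * (1 - t) = (t⁻¹ - 1) * t ^ s := by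
    have := ht.1.ne'
    field_simp
  rw [h2]
  exact mul_le_mul_of_nonneg_right (by linarith) (Real.rpow_nonneg ht.1.le s)

theorem bernKernelDeriv_nonneg {t : ℝ} (ht : t ∈ Ioo (0 : ℝ) 1) (s : ℝ) :
    0 ≤ bernKernelDeriv s t :=
  (Real.rpow_nonneg ht.1.le s).trans (rpow_le_bernKernelDeriv ht s)

theorem bernKernelDeriv_le_inv {t c s : ℝ} (ht : t ∈ Ioo (0 : ℝ) 1) (hc : 0 < c) (hc1 : c ≤ 1)
    (hcs : c ≤ s) : bernKernelDeriv s t ≤ c⁻¹ := by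
  have hlog : 0 ≤ -Real.log t := by linarith [Real.log_nonpos ht.1.le ht.2.le]
  have h1 : t ^ s ≤ t ^ c := Real.rpow_le_rpow_of_exponent_ge ht.1 ht.2.le hcs
  have h2 : t ≤ t ^ c := by
    simpa using Real.rpow_le_rpow_of_exponent_ge ht.1 ht.2.le hc1
  have hpos : 0 < t ^ c := Real.rpow_pos_of_pos ht.1 c
  have h3 := Real.one_sub_inv_le_log_of_pos hpos
  rw [Real.log_rpow ht.1] at h3
  have h4 : c * (-Real.log t) * t ^ c ≤ 1 - t ^ c := by
    have h5 := mul_le_mul_of_nonneg_right h3 hpos.le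
    rw [sub_mul, inv_mul_cancel₀ hpos.ne'] at h5
    linarith
  rw [bernKernelDeriv, div_le_iff₀ (by linarith [ht.2]), inv_mul_eq_div, le_div_iff₀ hc]
  nlinarith [mul_le_mul_of_nonneg_left h1 (mul_nonneg hc.le hlog)]

section Measure

variable {ν : Measure ℝ} [IsFiniteMeasure ν]

theorem integrable_bernKernelReal (hν : ∀ᵐ t ∂ν, t ∈ Ioo (0 : ℝ) 1) {s : ℝ} (hs : 0 ≤ s) :
    Integrable (bernKernelReal s) ν := by
  refine Integrable.of_bound (measurable_bernKernelReal s).aestronglyMeasurable (⌈s⌉₊ : ℝ) ?_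
  filter_upwards [hν] with t ht
  have h0 : 0 ≤ bernKernelReal s t := by
    rw [bernKernelReal_of_lt ht.2]
    exact div_nonneg (by linarith [Real.rpow_le_one ht.1.le ht.2.le hs]) (by linarith [ht.2])
  rw [Real.norm_of_nonneg h0]
  refine (bernKernelReal_mono ht (Nat.le_ceil s)).trans ?_
  rw [bernKernelReal_natCast ht.2]
  calc ∑ k ∈ Finset.range ⌈s⌉₊, t ^ k ≤ ∑ k ∈ Finset.range ⌈s⌉₊, (1 : ℝ) :=
        Finset.sum_le_sum fun k _ => pow_le_one₀ ht.1.le ht.2.le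
    _ = ⌈s⌉₊ := by simp

theorem integrable_bernKernelDeriv (hν : ∀ᵐ t ∂ν, t ∈ Ioo (0 : ℝ) 1) {s : ℝ} (hs : 0 < s) :
    Integrable (bernKernelDeriv s) ν := by
  refine Integrable.of_bound (measurable_bernKernelDeriv s).aestronglyMeasurable (min s 1)⁻¹ ?_
  filter_upwards [hν] with t ht
  rw [Real.norm_of_nonneg (bernKernelDeriv_nonneg ht s)]
  exact bernKernelDeriv_le_inv ht (lt_min hs one_pos) (min_le_right _ _) (min_le_left _ _)

theorem integrable_pow_of_ae_mem_Ioo (hν : ∀ᵐ t ∂ν, t ∈ Ioo (0 : ℝ) 1) (n : ℕ) :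
    Integrable (fun t : ℝ => t ^ n) ν := by
  refine Integrable.of_bound (by fun_prop) 1 ?_
  filter_upwards [hν] with t ht
  rw [Real.norm_of_nonneg (pow_nonneg ht.1.le n)]
  exact pow_le_one₀ ht.1.le ht.2.le

theorem hasDerivAt_integral_bernKernelReal (hν : ∀ᵐ t ∂ν, t ∈ Ioo (0 : ℝ) 1) {s : ℝ}
    (hs : 0 < s) :
    HasDerivAt (fun x => ∫ t, bernKernelReal x t ∂ν) (∫ t, bernKernelDeriv s t ∂ν) s := by
  have hc : 0 < min (s / 2) 1 := lt_min (by linarith) one_pos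
  refine (hasDerivAt_integral_of_dominated_loc_of_deriv_le (F := bernKernelReal)
    (F' := bernKernelDeriv) (bound := fun _ => (min (s / 2) 1)⁻¹)
    (Ioi_mem_nhds (by linarith : s / 2 < s))
    (Eventually.of_forall fun x => (measurable_bernKernelReal x).aestronglyMeasurable)
    (integrable_bernKernelReal hν hs.le) (measurable_bernKernelDeriv s).aestronglyMeasurable
    ?_ (integrable_const _) ?_).2
  · filter_upwards [hν] with t ht x hx
    rw [Real.norm_of_nonneg (bernKernelDeriv_nonneg ht x)]
    exact bernKernelDeriv_le_inv ht hc (min_le_right _ _) ((min_le_left _ _).trans hx.le)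
  · filter_upwards [hν] with t ht x _
    exact hasDerivAt_bernKernelReal ht x

theorem integral_bernKernelReal_natCast (hν : ∀ᵐ t ∂ν, t ∈ Ioo (0 : ℝ) 1)
    (hmom : ∀ n : ℕ, ∫ t, t ^ n ∂ν = fpSeq n) (n : ℕ) :
    ∫ t, bernKernelReal (n + 1 : ℕ) t ∂ν = fpSum n := by
  have h : bernKernelReal (n + 1 : ℕ) =ᵐ[ν] fun t => ∑ k ∈ Finset.range (n + 1), t ^ k := by
    filter_upwards [hν] with t ht using bernKernelReal_natCast ht.2 _
  rw [integral_congr_ae h, integral_finsetSum _ fun k _ => integrable_pow_of_ae_mem_Ioo hν k]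
  simp only [hmom, fpSum]

theorem integral_bernKernelReal_mono (hν : ∀ᵐ t ∂ν, t ∈ Ioo (0 : ℝ) 1) {s r : ℝ} (hs : 0 ≤ s)
    (h : s ≤ r) : ∫ t, bernKernelReal s t ∂ν ≤ ∫ t, bernKernelReal r t ∂ν :=
  integral_mono_ae (integrable_bernKernelReal hν hs) (integrable_bernKernelReal hν (hs.trans h))
    (hν.mono fun _ ht => bernKernelReal_mono ht h)

theorem fpSeq_le_integral_bernKernelDeriv (hν : ∀ᵐ t ∂ν, t ∈ Ioo (0 : ℝ) 1)
    (hmom : ∀ n : ℕ, ∫ t, t ^ n ∂ν = fpSeq n) {s : ℝ} (hs : 0 < s) {n : ℕ} (hn : s ≤ n) :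
    fpSeq n ≤ ∫ t, bernKernelDeriv s t ∂ν := by
  rw [← hmom]
  refine integral_mono_ae (integrable_pow_of_ae_mem_Ioo hν n) (integrable_bernKernelDeriv hν hs) ?_
  filter_upwards [hν] with t ht
  rw [← Real.rpow_natCast]
  exact (Real.rpow_le_rpow_of_exponent_ge ht.1 ht.2.le hn).trans (rpow_le_bernKernelDeriv ht s)

theorem integral_bernKernelDeriv_le_fpSeq (hν : ∀ᵐ t ∂ν, t ∈ Ioo (0 : ℝ) 1)
    (hmom : ∀ n : ℕ, ∫ t, t ^ n ∂ν = fpSeq n) {s : ℝ} (hs : 0 < s) {n : ℕ} (hn : n ≤ s - 1) :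
    ∫ t, bernKernelDeriv s t ∂ν ≤ fpSeq n := by
  rw [← hmom]
  refine integral_mono_ae (integrable_bernKernelDeriv hν hs) (integrable_pow_of_ae_mem_Ioo hν n) ?_
  filter_upwards [hν] with t ht
  rw [← Real.rpow_natCast]
  exact (bernKernelDeriv_le_rpow ht s).trans (Real.rpow_le_rpow_of_exponent_ge ht.1 ht.2.le hn)

theorem tendsto_integral_bernKernelReal_div_sqrt (hν : ∀ᵐ t ∂ν, t ∈ Ioo (0 : ℝ) 1)
    (hmom : ∀ n : ℕ, ∫ t, t ^ n ∂ν = fpSeq n) :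
    Tendsto (fun s : ℝ => (∫ t, bernKernelReal s t ∂ν) / Real.sqrt (2 * s)) atTop (nhds 1) := by
  refine tendsto_of_tendsto_of_tendsto_of_le_of_le'
    (tendsto_sqrt_two_mul_add_sub_div (-3) 1) (tendsto_sqrt_two_mul_add_div 1) ?_ ?_
  · filter_upwards [eventually_ge_atTop 1] with s hs
    obtain ⟨n, hn⟩ := Nat.exists_eq_add_of_le' ((Nat.one_le_floor_iff s).2 hs)
    have h1 := Nat.floor_le (zero_le_one.trans hs)
    have h2 := Nat.lt_floor_add_one s
    rw [hn] at h1 h2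
    have h3 := integral_bernKernelReal_mono hν (Nat.cast_nonneg _) h1
    rw [integral_bernKernelReal_natCast hν hmom] at h3
    have h4 : Real.sqrt (2 * s + -3) ≤ Real.sqrt (2 * n + 1) := by
      push_cast at h2
      exact Real.sqrt_le_sqrt (by linarith)
    have h5 := sqrt_sub_one_le_fpSum n
    gcongr
    linarith
  · filter_upwards [eventually_ge_atTop 1] with s hs
    obtain ⟨n, hn⟩ := Nat.exists_eq_add_of_le'
      (Nat.one_le_ceil_iff.2 (zero_lt_one.trans_le hs))
    have h1 := Nat.le_ceil s
    have h2 := Nat.ceil_lt_add_one (zero_le_one.trans hs)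
    rw [hn] at h1 h2
    have h3 := integral_bernKernelReal_mono hν (zero_le_one.trans hs) h1
    rw [integral_bernKernelReal_natCast hν hmom] at h3
    have h4 : Real.sqrt (2 * n + 1) ≤ Real.sqrt (2 * s + 1) := by
      push_cast at h2
      exact Real.sqrt_le_sqrt (by linarith)
    have h5 := fpSum_le_sqrt n
    gcongr
    linarith

theorem tendsto_integral_bernKernelDeriv_mul_sqrt (hν : ∀ᵐ t ∂ν, t ∈ Ioo (0 : ℝ) 1)
    (hmom : ∀ n : ℕ, ∫ t, t ^ n ∂ν = fpSeq n) :
    Tendsto (fun s : ℝ => (∫ t, bernKernelDeriv s t ∂ν) * Real.sqrt (2 * s)) atTop (nhds 1) := by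
  have hlow := (tendsto_sqrt_two_mul_add_div 3).inv₀ one_ne_zero
  have hupp := (tendsto_sqrt_two_mul_add_sub_div (-3) 1).inv₀ one_ne_zero
  rw [inv_one] at hlow hupp
  refine tendsto_of_tendsto_of_tendsto_of_le_of_le' hlow hupp ?_ ?_
  · filter_upwards [eventually_ge_atTop 1] with s hs
    have hs0 : 0 < s := zero_lt_one.trans_le hs
    have h1 := fpSeq_le_integral_bernKernelDeriv hν hmom hs0 (Nat.le_ceil s)
    have h2 := Nat.ceil_lt_add_one hs0.le
    rw [inv_div, div_eq_inv_mul]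
    refine mul_le_mul_of_nonneg_right (le_trans ?_ h1) (Real.sqrt_nonneg _)
    rw [fpSeq_eq_inv]
    exact inv_anti₀ (fpSum_pos _)
      ((fpSum_le_sqrt _).trans (Real.sqrt_le_sqrt (by linarith)))
  · filter_upwards [eventually_ge_atTop 3] with s hs
    have hs0 : 0 < s := by linarith
    have h1 := integral_bernKernelDeriv_le_fpSeq hν hmom hs0
      (Nat.floor_le (by linarith : 0 ≤ s - 1))
    have h2 := Nat.lt_floor_add_one (s - 1)
    rw [inv_div, div_eq_inv_mul]
    refine mul_le_mul_of_nonneg_right (h1.trans ?_) (Real.sqrt_nonneg _)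
    rw [fpSeq_eq_inv]
    refine inv_anti₀ ?_ (le_trans (sub_le_sub_right (Real.sqrt_le_sqrt ?_) 1)
      (sqrt_sub_one_le_fpSum _))
    · rw [sub_pos, Real.lt_sqrt zero_le_one]
      linarith
    · linarith

end Measure

theorem measure_singleton_one_eq_zero {ν : Measure ℝ} [IsFiniteMeasure ν]
    (hν : ∀ᵐ t ∂ν, t ∈ Icc (0 : ℝ) 1) (hmom : ∀ n : ℕ, ∫ t, t ^ n ∂ν = fpSeq n) :
    ν {1} = 0 := by
  have hle (n : ℕ) : ν.real {1} ≤ fpSeq n := by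
    rw [← hmom, ← integral_indicator_one (measurableSet_singleton 1)]
    refine integral_mono_ae
      ((integrable_const (1 : ℝ)).indicator (measurableSet_singleton 1)) ?_ ?_
    · refine Integrable.of_bound (by fun_prop) 1 ?_
      filter_upwards [hν] with t ht
      rw [Real.norm_of_nonneg (pow_nonneg ht.1 n)]
      exact pow_le_one₀ ht.1 ht.2
    · filter_upwards [hν] with t ht
      by_cases h : t = 1
      · simp [h]
      · simpa [h] using pow_nonneg ht.1 n
  rw [← measureReal_eq_zero_iff]
  exact le_antisymm (ge_of_tendsto' tendsto_fpSeq hle) measureReal_nonneg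

theorem stmt_13 (μ : Measure ℝ) [IsProbabilityMeasure μ]
    (hsupp : μ (Set.Icc (0:ℝ) 1)ᶜ = 0) (h0 : μ {0} = 0)
    (hmom : ∀ n : ℕ, ∫ t in Set.Icc (0:ℝ) 1, t ^ n ∂μ = fpSeq n) :
    (∀ s : ℝ, 0 < s →
      HasDerivAt (bernTransformReal μ)
        (∫ t in Set.Icc (0:ℝ) 1, (-Real.log t) * t ^ s / (1 - t) ∂μ) s) ∧
    Tendsto (fun s : ℝ => bernTransformReal μ s / Real.sqrt (2 * s))
      atTop (nhds 1) ∧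
    Tendsto (fun s : ℝ => deriv (bernTransformReal μ) s * Real.sqrt (2 * s))
      atTop (nhds 1) := by
  have hres : μ.restrict (Icc 0 1) = μ := Measure.restrict_eq_self_of_ae_mem hsupp
  have hmom' : ∀ n : ℕ, ∫ t, t ^ n ∂μ = fpSeq n := by simpa only [hres] using hmom
  have h1 : μ {1} = 0 := measure_singleton_one_eq_zero hsupp hmom'
  have hμ : ∀ᵐ t ∂μ, t ∈ Ioo (0 : ℝ) 1 := by
    filter_upwards [show ∀ᵐ t ∂μ, t ∈ Icc (0 : ℝ) 1 from hsupp, measure_eq_zero_iff_ae_notMem.1 h0,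
      measure_eq_zero_iff_ae_notMem.1 h1] with t ht ht0 ht1
    exact ⟨lt_of_le_of_ne ht.1 (Ne.symm ht0), lt_of_le_of_ne ht.2 ht1⟩
  have hf : bernTransformReal μ = fun s => ∫ t, bernKernelReal s t ∂μ := by
    funext s
    rw [bernTransformReal, hres]
  rw [hres, hf]
  refine ⟨fun s hs => hasDerivAt_integral_bernKernelReal hμ hs,
    tendsto_integral_bernKernelReal_div_sqrt hμ hmom', ?_⟩
  refine (tendsto_integral_bernKernelDeriv_mul_sqrt hμ hmom').congr' ?_
  filter_upwards [eventually_gt_atTop 0] with s hs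
  rw [(hasDerivAt_integral_bernKernelReal hμ hs).deriv]
end

section
/- Let (σ_n)_{n≥1} be positive measures on [0,∞) with ∫₀^∞ dσ_n(x)/(x+1) < ∞ for each n, set φ_n(z) = ∫₀^∞ dσ_n(x)/(x+z), and assume φ_n → φ uniformly on compact subsets of the half-plane {Re z > 0}, where φ is holomorphic on {Re z > 0}. Then there exist a real a ≥ 0 and a positive measure σ on [0,∞) with ∫₀^∞ dσ(x)/(x+1) < ∞ such that φ(z) = a + ∫₀^∞ dσ(x)/(x+z) for all z with Re z > 0; moreover ∫ g dσ_n → ∫ g dσ for every continuous function g : [0,∞) → ℝ with compact support, and φ_n converges to the function z ↦ a + ∫₀^∞ dσ(x)/(x+z) uniformly on compact subsets of ℂ ∖ (−∞,0]. -/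
open MeasureTheory Set Filter

open scoped NNReal Topology BoundedContinuousFunction CompactlySupported

/-- The family of functions `t ↦ (1 + a t)⁻¹` on the unit interval, for `a ≥ 0`. -/
noncomputable def realResolvent : C(ℝ≥0, C(unitInterval, ℝ)) :=
  ContinuousMap.curry
    ⟨fun p => (1 + (p.1 : ℝ) * (p.2 : ℝ))⁻¹, by
      refine Continuous.inv₀ (by fun_prop) fun p => ?_
      have := mul_nonneg p.1.2 p.2.2.1
      simp only [NNReal.val_eq_coe] at this
      positivity⟩

lemma realResolvent_apply (a : ℝ≥0) (t : unitInterval) :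
    realResolvent a t = (1 + (a : ℝ) * (t : ℝ))⁻¹ := rfl

/-- A closed subspace of `C([0, 1])` containing all `t ↦ (1 + a t)⁻¹` is everything. -/
lemma eq_top_of_realResolvent_mem (S : Submodule ℝ C(unitInterval, ℝ))
    (hS : IsClosed (S : Set C(unitInterval, ℝ))) (h : ∀ a, realResolvent a ∈ S) : S = ⊤ := by
  let X : C(unitInterval, ℝ) := ⟨Subtype.val, continuous_subtype_val⟩
  have hzero : realResolvent 0 = 1 := by
    ext t; simp [realResolvent_apply]
  have key : ∀ k : ℕ, ∀ a, X ^ k * realResolvent a ∈ S := by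
    intro k
    induction k with
    | zero => simpa using h
    | succ k ih =>
      have hpos : ∀ a, a ≠ 0 → X ^ (k + 1) * realResolvent a ∈ S := by
        intro a ha
        have : X ^ (k + 1) * realResolvent a
            = (a : ℝ)⁻¹ • (X ^ k * realResolvent 0 - X ^ k * realResolvent a) := by
          ext t
          have h1 : (1 + (a : ℝ) * (t : ℝ)) ≠ 0 := by
            have := mul_nonneg a.2 t.2.1
            simp only [NNReal.val_eq_coe] at this
            positivity
          have h2 : (a : ℝ) ≠ 0 := by exact_mod_cast ha
          simp only [ContinuousMap.mul_apply, ContinuousMap.pow_apply, ContinuousMap.smul_apply,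
            ContinuousMap.sub_apply, hzero, realResolvent_apply, ContinuousMap.one_apply,
            smul_eq_mul, X, ContinuousMap.coe_mk]
          field_simp
          ring
        rw [this]
        exact S.smul_mem _ (S.sub_mem (ih 0) (ih a))
      intro a
      by_cases ha : a = 0
      · subst ha
        have ht : Tendsto (fun a => X ^ (k + 1) * realResolvent a) (𝓝[≠] 0)
            (𝓝 (X ^ (k + 1) * realResolvent 0)) :=
          ((continuous_const.mul realResolvent.continuous).tendsto 0).mono_left nhdsWithin_le_nhds
        have : (𝓝[≠] (0 : ℝ≥0)).NeBot := by
          have : (𝓝[>] (0 : ℝ≥0)).NeBot := inferInstance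
          exact this.mono (nhdsWithin_mono _ fun x hx => ne_of_gt hx)
        exact hS.mem_of_tendsto ht (eventually_nhdsWithin_of_forall fun a ha => hpos a ha)
      · exact hpos a ha
  have hpoly : (polynomialFunctions unitInterval : Set C(unitInterval, ℝ)) ⊆ S := by
    rintro _ ⟨p, -, rfl⟩
    have hp : (Polynomial.toContinuousMapOnAlgHom unitInterval) p
        = p.sum fun k c => c • (X ^ k * realResolvent 0) := by
      ext t
      simp [Polynomial.eval_eq_sum, Polynomial.sum, hzero, X]
    change (Polynomial.toContinuousMapOnAlgHom unitInterval) p ∈ S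
    rw [hp]
    exact S.sum_mem fun k _ => S.smul_mem _ (key k 0)
  rw [eq_top_iff]
  intro f _
  have hf : f ∈ (polynomialFunctions unitInterval).topologicalClosure := by
    rw [polynomialFunctions_closure_eq_top']; trivial
  exact closure_minimal hpoly hS hf

lemma norm_integral_le_of_real_univ_le {E : Type*} [NormedAddCommGroup E] [NormedSpace ℝ E]
    {μ : Measure unitInterval} [IsFiniteMeasure μ] {C : ℝ} (hC : μ.real univ ≤ C)
    (f : C(unitInterval, E)) :
    ‖∫ t, f t ∂μ‖ ≤ C * ‖f‖ := by
  have := norm_integral_le_of_norm_le_const (μ := μ) (f := f) (C := ‖f‖)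
    (ae_of_all _ f.norm_coe_le_norm)
  rw [mul_comm] at this
  exact this.trans (by gcongr)

lemma integrable_continuousMap {E : Type*} [NormedAddCommGroup E]
    (μ : Measure unitInterval) [IsFiniteMeasure μ] (f : C(unitInterval, E)) : Integrable f μ :=
  f.continuous.integrable_of_hasCompactSupport (HasCompactSupport.of_compactSpace f)

/-- The continuous functions whose integrals against a sequence of measures converge. -/
def convergentIntegrands (ρ : ℕ → Measure unitInterval) [∀ n, IsFiniteMeasure (ρ n)] :
    Submodule ℝ C(unitInterval, ℝ) where
  carrier := {f | ∃ l, Tendsto (fun n => ∫ t, f t ∂ρ n) atTop (𝓝 l)}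
  add_mem' := by
    rintro f g ⟨l, hl⟩ ⟨m, hm⟩
    refine ⟨l + m, (hl.add hm).congr fun n => ?_⟩
    exact (integral_add (integrable_continuousMap _ f) (integrable_continuousMap _ g)).symm
  zero_mem' := ⟨0, by simp⟩
  smul_mem' := by
    rintro c f ⟨l, hl⟩
    refine ⟨c * l, (hl.const_mul c).congr fun n => ?_⟩
    exact (integral_const_mul c f).symm

lemma isClosed_convergentIntegrands (ρ : ℕ → Measure unitInterval) [∀ n, IsFiniteMeasure (ρ n)]
    {C : ℝ} (hC : ∀ n, (ρ n).real univ ≤ C) :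
    IsClosed (convergentIntegrands ρ : Set C(unitInterval, ℝ)) := by
  rw [← closure_subset_iff_isClosed]
  intro f hf
  refine cauchySeq_tendsto_of_complete (Metric.cauchySeq_iff'.2 fun ε hε => ?_)
  have hC0 : 0 ≤ C := measureReal_nonneg.trans (hC 0)
  obtain ⟨g, ⟨l, hg⟩, hfg⟩ := Metric.mem_closure_iff.1 hf (ε / (3 * (C + 1))) (by positivity)
  obtain ⟨N, hN⟩ := Metric.cauchySeq_iff'.1 hg.cauchySeq (ε / 3) (by positivity)
  refine ⟨N, fun n hn => ?_⟩
  have hd : ∀ m, dist (∫ t, f t ∂ρ m) (∫ t, g t ∂ρ m) < ε / 3 := by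
    intro m
    have h1 := norm_integral_le_of_real_univ_le (hC m) (f - g)
    rw [dist_eq_norm, ← integral_sub (integrable_continuousMap _ f) (integrable_continuousMap _ g)]
    rw [dist_eq_norm] at hfg
    calc _ ≤ C * ‖f - g‖ := h1
      _ ≤ (C + 1) * ‖f - g‖ := by gcongr; linarith
      _ < (C + 1) * (ε / (3 * (C + 1))) := by gcongr
      _ = ε / 3 := by field_simp
  have h1 := hd n
  have h2 := hd N
  rw [dist_comm] at h2
  have h3 := dist_triangle4 (∫ t, f t ∂ρ n) (∫ t, g t ∂ρ n) (∫ t, g t ∂ρ N) (∫ t, f t ∂ρ N)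
  have := hN n hn
  linarith

/-- Finite measures on `[0, 1]` with bounded masses whose integrals of every `t ↦ (1 + a t)⁻¹`
converge have a weak limit. -/
lemma exists_weakLimit_of_realResolvent (ρ : ℕ → FiniteMeasure unitInterval) {C : ℝ}
    (hC : ∀ n, (ρ n : Measure unitInterval).real univ ≤ C)
    (h : ∀ a, ∃ l, Tendsto (fun n => ∫ t, realResolvent a t ∂(ρ n : Measure unitInterval))
      atTop (𝓝 l)) :
    ∃ ρ' : FiniteMeasure unitInterval, Tendsto ρ atTop (𝓝 ρ') := by
  have htop : convergentIntegrands (fun n => (ρ n : Measure unitInterval)) = ⊤ :=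
    eq_top_of_realResolvent_mem _ (isClosed_convergentIntegrands _ hC) h
  have hall : ∀ f : C(unitInterval, ℝ), ∃ l,
      Tendsto (fun n => ∫ t, f t ∂(ρ n : Measure unitInterval))
      atTop (𝓝 l) :=
    fun f => by
      have : f ∈ convergentIntegrands (fun n => (ρ n : Measure unitInterval)) := by
        rw [htop]; trivial
      exact this
  choose L hL using hall
  let Λ : C_c(unitInterval, ℝ) →ₗ[ℝ] ℝ :=
    { toFun := fun f => L f.toContinuousMap
      map_add' := fun f g => by
        refine tendsto_nhds_unique (hL _) (((hL f.toContinuousMap).add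
          (hL g.toContinuousMap)).congr fun n => ?_)
        exact (integral_add (integrable_continuousMap _ f.toContinuousMap)
          (integrable_continuousMap _ g.toContinuousMap)).symm
      map_smul' := fun c f => by
        refine tendsto_nhds_unique (hL _) (((hL f.toContinuousMap).const_mul c).congr fun n => ?_)
        exact (integral_const_mul c f.toContinuousMap).symm }
  let Λ' : C_c(unitInterval, ℝ) →ₚ[ℝ] ℝ := PositiveLinearMap.mk₀ Λ fun f hf =>
    ge_of_tendsto' (hL f.toContinuousMap) fun n => integral_nonneg fun t => hf t
  refine ⟨⟨RealRMK.rieszMeasure Λ', inferInstance⟩,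
    FiniteMeasure.tendsto_iff_forall_integral_tendsto.2 fun f => ?_⟩
  have hf := RealRMK.integral_rieszMeasure Λ' (CompactlySupportedContinuousMap.continuousMapEquiv
    f.toContinuousMap)
  exact (hL f.toContinuousMap).trans (le_of_eq (congrArg 𝓝 hf.symm))

/-- The family of functions `t ↦ (1 + (z - 1) t)⁻¹` on the unit interval, for `z` in the slit
plane. -/
noncomputable def slitResolvent : C(Complex.slitPlane, C(unitInterval, ℂ)) :=
  ContinuousMap.curry
    ⟨fun p => (1 + ((p.1 : ℂ) - 1) * ((p.2 : ℝ) : ℂ))⁻¹, by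
      refine Continuous.inv₀ (by fun_prop) fun p => Complex.slitPlane_ne_zero ?_
      have := Complex.starConvex_one_slitPlane p.1.2 (sub_nonneg.2 p.2.2.2) p.2.2.1 (by ring)
      convert this using 1
      simp only [Complex.real_smul]
      push_cast
      ring⟩

lemma slitResolvent_apply (z : Complex.slitPlane) (t : unitInterval) :
    slitResolvent z t = (1 + ((z : ℂ) - 1) * ((t : ℝ) : ℂ))⁻¹ := rfl

lemma tendsto_integral_of_tendsto {ρ : ℕ → FiniteMeasure unitInterval}
    {ρ' : FiniteMeasure unitInterval}
    (h : Tendsto ρ atTop (𝓝 ρ')) {𝕜 : Type*} [RCLike 𝕜] (f : C(unitInterval, 𝕜)) :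
    Tendsto (fun n => ∫ t, f t ∂(ρ n : Measure unitInterval)) atTop
      (𝓝 (∫ t, f t ∂(ρ' : Measure unitInterval))) :=
  (FiniteMeasure.tendsto_iff_forall_integral_rclike_tendsto 𝕜).1 h
    (BoundedContinuousFunction.mkOfCompact f)

lemma tendstoUniformly_integral_of_tendsto {ρ : ℕ → FiniteMeasure unitInterval}
    {ρ' : FiniteMeasure unitInterval}
    (h : Tendsto ρ atTop (𝓝 ρ')) {C : ℝ} (hC : ∀ n, (ρ n : Measure unitInterval).real univ ≤ C)
    {X : Type*} [TopologicalSpace X] [CompactSpace X] (G : C(X, C(unitInterval, ℂ))) :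
    TendstoUniformly (fun n x => ∫ t, G x t ∂(ρ n : Measure unitInterval))
      (fun x => ∫ t, G x t ∂(ρ' : Measure unitInterval)) atTop := by
  have hE : Equicontinuous (fun (n : ℕ) (x : X) => ∫ t, G x t ∂(ρ n : Measure unitInterval)) := by
    intro x
    refine Metric.equicontinuousAt_of_continuity_modulus (fun y => C * dist (G x) (G y)) ?_ _
      (Eventually.of_forall fun y n => ?_)
    · have : Continuous fun y => C * dist (G x) (G y) := by fun_prop
      simpa using this.tendsto x
    · rw [dist_eq_norm, dist_eq_norm, ← integral_sub (integrable_continuousMap _ (G x))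
        (integrable_continuousMap _ (G y))]
      exact norm_integral_le_of_real_univ_le (hC n) (G x - G y)
  have := (hE.tendsto_uniformFun_iff_pi atTop (fun x => ∫ t, G x t ∂(ρ' : Measure unitInterval))).2
    (tendsto_pi_nhds.2 fun x => tendsto_integral_of_tendsto h (G x))
  exact UniformFun.tendsto_iff_tendstoUniformly.1 this

lemma ae_nonneg_of_measure_Iio_zero {σ : Measure ℝ} (hσ : σ (Iio 0) = 0) : ∀ᵐ x ∂σ, 0 ≤ x := by
  rw [ae_iff]
  simpa [Iio_def] using hσ

lemma restrict_Ici_zero_of_measure_Iio_zero {σ : Measure ℝ} (hσ : σ (Iio 0) = 0) :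
    σ.restrict (Ici 0) = σ :=
  Measure.restrict_eq_self_of_ae_mem (ae_nonneg_of_measure_Iio_zero hσ)

/-- The map `x ↦ (x + 1)⁻¹` from `[0, ∞)` to `[0, 1]`, extended to the real line. -/
noncomputable def toInterval (x : ℝ) : unitInterval := projIcc 0 1 zero_le_one (x + 1)⁻¹

lemma measurable_toInterval : Measurable toInterval :=
  continuous_projIcc.measurable.comp (by fun_prop)

lemma coe_toInterval {x : ℝ} (hx : 0 ≤ x) : (toInterval x : ℝ) = (x + 1)⁻¹ := by
  have h : (x + 1)⁻¹ ∈ Icc (0 : ℝ) 1 := ⟨by positivity, inv_le_one_of_one_le₀ (by linarith)⟩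
  rw [toInterval, projIcc_of_mem _ h]

/-- The measure `dσ(x) / (x + 1)` transported to `[0, 1]` by `x ↦ (x + 1)⁻¹`. -/
noncomputable def compactify (σ : Measure ℝ) : Measure unitInterval :=
  (σ.withDensity fun x => ((x + 1)⁻¹.toNNReal : ℝ≥0)).map toInterval

lemma isFiniteMeasure_compactify {σ : Measure ℝ}
    (hfin : ∫⁻ x, ENNReal.ofReal (1 / (x + 1)) ∂σ < ⊤) : IsFiniteMeasure (compactify σ) := by
  have : IsFiniteMeasure (σ.withDensity fun x => ((x + 1)⁻¹.toNNReal : ℝ≥0)) := by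
    refine isFiniteMeasure_withDensity ?_
    simpa [ENNReal.ofReal] using hfin.ne
  unfold compactify
  infer_instance

lemma integral_compactify {E : Type*} [NormedAddCommGroup E] [NormedSpace ℝ E]
    [SecondCountableTopologyEither unitInterval E]
    {σ : Measure ℝ} (hσ : σ (Iio 0) = 0) (f : C(unitInterval, E)) :
    ∫ t, f t ∂compactify σ = ∫ x, (x + 1)⁻¹ • f (toInterval x) ∂σ := by
  rw [compactify, integral_map measurable_toInterval.aemeasurable
    f.continuous.aestronglyMeasurable, integral_withDensity_eq_integral_smul (by fun_prop)]
  refine integral_congr_ae ?_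
  filter_upwards [ae_nonneg_of_measure_Iio_zero hσ] with x hx
  rw [NNReal.smul_def, Real.coe_toNNReal _ (by positivity)]

lemma integral_slitResolvent_compactify {σ : Measure ℝ} (hσ : σ (Iio 0) = 0)
    (z : Complex.slitPlane) :
    ∫ t, slitResolvent z t ∂compactify σ = ∫ x : ℝ, ((x : ℂ) + z)⁻¹ ∂σ := by
  rw [integral_compactify hσ]
  refine integral_congr_ae ?_
  filter_upwards [ae_nonneg_of_measure_Iio_zero hσ] with x hx
  have h1 : (x : ℂ) + 1 ≠ 0 := by
    have : x + 1 ≠ 0 := by positivity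
    exact_mod_cast this
  rw [slitResolvent_apply, coe_toInterval hx, Complex.real_smul]
  push_cast
  rw [← mul_inv]
  congr 1
  field_simp
  ring

/-- The measure on `[0, ∞)` obtained from `dρ(t) / t` on `(0, 1]` by `t ↦ t⁻¹ - 1`. -/
noncomputable def decompactify (ρ : Measure unitInterval) : Measure ℝ :=
  (ρ.withDensity fun t => ((t : ℝ).toNNReal⁻¹ : ℝ≥0)).map
    fun t : unitInterval => (t : ℝ)⁻¹ - 1

lemma lintegral_decompactify (ρ : Measure unitInterval) {g : ℝ → ENNReal} (hg : Measurable g) :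
    ∫⁻ x, g x ∂decompactify ρ
      = ∫⁻ t : unitInterval, ((t : ℝ).toNNReal⁻¹ : ℝ≥0) * g ((t : ℝ)⁻¹ - 1) ∂ρ := by
  have hm : Measurable fun t : unitInterval => (t : ℝ)⁻¹ - 1 := by fun_prop
  rw [decompactify, lintegral_map hg hm]
  exact lintegral_withDensity_eq_lintegral_mul _ (by fun_prop) (hg.comp hm)

lemma integral_decompactify {E : Type*} [NormedAddCommGroup E] [NormedSpace ℝ E]
    (ρ : Measure unitInterval) {g : ℝ → E} (hg : StronglyMeasurable g) :
    ∫ x, g x ∂decompactify ρ = ∫ t : unitInterval, (t : ℝ)⁻¹ • g ((t : ℝ)⁻¹ - 1) ∂ρ := by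
  have hm : Measurable fun t : unitInterval => (t : ℝ)⁻¹ - 1 := by fun_prop
  rw [decompactify, integral_map hm.aemeasurable hg.aestronglyMeasurable,
    integral_withDensity_eq_integral_smul (by fun_prop)]
  refine integral_congr_ae (ae_of_all _ fun t => ?_)
  simp only
  rw [NNReal.smul_def, NNReal.coe_inv, Real.coe_toNNReal _ t.2.1]

lemma decompactify_Iio_zero (ρ : Measure unitInterval) : decompactify ρ (Iio 0) = 0 := by
  rw [← lintegral_indicator_one measurableSet_Iio,
    lintegral_decompactify ρ (measurable_one.indicator measurableSet_Iio)]
  refine (lintegral_congr fun t => ?_).trans lintegral_zero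
  rcases t.2.1.eq_or_lt with h | h
  · simp [← h]
  · have := (one_le_inv₀ h).2 t.2.2
    simp [indicator, this]

lemma lintegral_decompactify_lt_top (ρ : Measure unitInterval) [IsFiniteMeasure ρ] :
    ∫⁻ x, ENNReal.ofReal (1 / (x + 1)) ∂decompactify ρ < ⊤ := by
  rw [lintegral_decompactify ρ (by fun_prop)]
  refine (lintegral_mono (g := fun _ => 1) fun t => ?_).trans_lt (by simp)
  rcases t.2.1.eq_or_lt with h | h
  · simp [← h]
  · have h0 : (t : ℝ).toNNReal ≠ 0 := by simpa using h
    simp only [sub_add_cancel, one_div, inv_inv, ENNReal.ofReal]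
    rw [← ENNReal.coe_mul, inv_mul_cancel₀ h0, ENNReal.coe_one]

lemma integral_slitResolvent_eq (ρ : Measure unitInterval) [IsFiniteMeasure ρ]
    (z : Complex.slitPlane) :
    ∫ t, slitResolvent z t ∂ρ
      = (ρ.real {0} : ℂ) + ∫ x : ℝ, ((x : ℂ) + z)⁻¹ ∂decompactify ρ := by
  have hg : Measurable fun x : ℝ => ((x : ℂ) + z)⁻¹ := by fun_prop
  have hind : Integrable (indicator {(0 : unitInterval)} fun _ => (1 : ℂ)) ρ :=
    (integrable_const _).indicator (measurableSet_singleton _)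
  have hint : ∫ t, (indicator {(0 : unitInterval)} fun _ => (1 : ℂ)) t ∂ρ = (ρ.real {0} : ℂ) := by
    rw [integral_indicator_const _ (measurableSet_singleton _)]
    simp
  rw [integral_decompactify ρ hg.stronglyMeasurable, ← hint, ← sub_eq_iff_eq_add',
    ← integral_sub (integrable_continuousMap ρ (slitResolvent z)) hind]
  refine integral_congr_ae (ae_of_all _ fun t => ?_)
  simp only [slitResolvent_apply]
  by_cases h : t = 0
  · simp [h]
  · have h1 : (t : ℝ) ≠ 0 := by simpa using h
    have h2 : ((t : ℝ) : ℂ) ≠ 0 := by exact_mod_cast h1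
    rw [indicator_of_notMem (by simpa using h), sub_zero, Complex.real_smul]
    push_cast
    rw [← mul_inv]
    congr 1
    field_simp
    ring

/-- A compactly supported function on `ℝ`, read on `[0, 1]` and divided by the weight. -/
lemma continuous_inv_mul_comp_inv_sub_one {g : ℝ → ℝ} (hg : Continuous g)
    (hc : HasCompactSupport g) :
    Continuous fun t : unitInterval => (t : ℝ)⁻¹ * g ((t : ℝ)⁻¹ - 1) := by
  rw [continuous_iff_continuousAt]
  intro t
  by_cases h : t = 0
  · subst h
    obtain ⟨R, hR⟩ := hc.isCompact.bddAbove
    have hz : ∀ x, R < x → g x = 0 := fun x hx =>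
      image_eq_zero_of_notMem_tsupport fun hx' => (hR hx').not_gt hx
    refine (continuousAt_const (y := (0 : ℝ))).congr ?_
    have hpos : (0 : ℝ) < (|R| + 1)⁻¹ := by positivity
    have : ∀ᶠ t : unitInterval in 𝓝 0, (t : ℝ) < (|R| + 1)⁻¹ :=
      (continuous_subtype_val.tendsto (0 : unitInterval)).eventually_lt_const hpos
    filter_upwards [this] with t ht
    rcases t.2.1.eq_or_lt with h0 | h0
    · simp [← h0]
    · rw [lt_inv_comm₀ h0 (by positivity)] at ht
      rw [hz _ (by linarith [le_abs_self R]), mul_zero]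
  · have h1 : (t : ℝ) ≠ 0 := by simpa using h
    have hi : ContinuousAt (fun t : unitInterval => (t : ℝ)⁻¹) t :=
      continuous_subtype_val.continuousAt.inv₀ h1
    exact hi.mul (hg.continuousAt.comp (hi.sub continuousAt_const))

lemma exists_continuousMap_integral_eq {g : ℝ → ℝ} (hg : Continuous g)
    (hc : HasCompactSupport g) : ∃ f : C(unitInterval, ℝ),
      (∀ σ : Measure ℝ, σ (Iio 0) = 0 → ∫ x, g x ∂σ = ∫ t, f t ∂compactify σ) ∧
      ∀ ρ : Measure unitInterval, ∫ x, g x ∂decompactify ρ = ∫ t, f t ∂ρ := by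
  refine ⟨⟨_, continuous_inv_mul_comp_inv_sub_one hg hc⟩, fun σ hσ => ?_, fun ρ => ?_⟩
  · rw [integral_compactify hσ]
    refine integral_congr_ae ?_
    filter_upwards [ae_nonneg_of_measure_Iio_zero hσ] with x hx
    have h1 : x + 1 ≠ 0 := by positivity
    simp [coe_toInterval hx, h1]
  · rw [integral_decompactify ρ hg.stronglyMeasurable]
    rfl

lemma tendsto_integral_realResolvent {ρ : ℕ → Measure unitInterval} {a : ℝ≥0}
    {z : Complex.slitPlane} (hz : (z : ℂ) = (a : ℝ) + 1) {l : ℂ}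
    (h : Tendsto (fun n => ∫ t, slitResolvent z t ∂ρ n) atTop (𝓝 l)) :
    Tendsto (fun n => ∫ t, realResolvent a t ∂ρ n) atTop (𝓝 l.re) := by
  refine ((Complex.continuous_re.tendsto l).comp h).congr fun n => ?_
  have : ∀ t, slitResolvent z t = ((realResolvent a t : ℝ) : ℂ) := fun t => by
    rw [slitResolvent_apply, realResolvent_apply, hz]
    push_cast
    ring
  simp only [Function.comp_apply, this, integral_complex_ofReal, Complex.ofReal_re]

theorem stmt_14
    (σ : ℕ → Measure ℝ)
    (hσsupp : ∀ n, σ n (Set.Iio (0:ℝ)) = 0)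
    (hσfin : ∀ n, ∫⁻ x in Set.Ici (0:ℝ), ENNReal.ofReal (1 / (x + 1)) ∂σ n < ⊤)
    (φ : ℂ → ℂ)
    (hφ : DifferentiableOn ℂ φ {z : ℂ | 0 < z.re})
    (hconv : ∀ K : Set ℂ, K ⊆ {z : ℂ | 0 < z.re} → IsCompact K →
      TendstoUniformlyOn
        (fun (n : ℕ) (z : ℂ) => ∫ x in Set.Ici (0:ℝ), ((x : ℂ) + z)⁻¹ ∂σ n)
        φ atTop K) :
    ∃ (a : ℝ) (σ' : Measure ℝ), 0 ≤ a ∧ σ' (Set.Iio (0:ℝ)) = 0 ∧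
      (∫⁻ x in Set.Ici (0:ℝ), ENNReal.ofReal (1 / (x + 1)) ∂σ' < ⊤) ∧
      (∀ z : ℂ, 0 < z.re →
        φ z = a + ∫ x in Set.Ici (0:ℝ), ((x : ℂ) + z)⁻¹ ∂σ') ∧
      (∀ g : ℝ → ℝ, Continuous g → HasCompactSupport g →
        Tendsto (fun n : ℕ => ∫ x, g x ∂σ n) atTop (nhds (∫ x, g x ∂σ'))) ∧
      (∀ K : Set ℂ, K ⊆ {z : ℂ | z.im ≠ 0 ∨ 0 < z.re} → IsCompact K →
        TendstoUniformlyOn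
          (fun (n : ℕ) (z : ℂ) => ∫ x in Set.Ici (0:ℝ), ((x : ℂ) + z)⁻¹ ∂σ n)
          (fun z : ℂ => a + ∫ x in Set.Ici (0:ℝ), ((x : ℂ) + z)⁻¹ ∂σ')
          atTop K) := by
  simp only [restrict_Ici_zero_of_measure_Iio_zero (hσsupp _)] at hσfin hconv ⊢
  have hpt : ∀ z : ℂ, 0 < z.re →
      Tendsto (fun n => ∫ x : ℝ, ((x : ℂ) + z)⁻¹ ∂σ n) atTop (𝓝 (φ z)) := fun z hz =>
    (hconv {z} (by simpa using hz) isCompact_singleton).tendsto_at (mem_singleton z)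
  let ρ : ℕ → FiniteMeasure unitInterval := fun n =>
    ⟨compactify (σ n), isFiniteMeasure_compactify (hσfin n)⟩
  have hρ : ∀ n, (ρ n : Measure unitInterval) = compactify (σ n) := fun _ => rfl
  have hres : ∀ a, ∃ l, Tendsto (fun n => ∫ t, realResolvent a t ∂(ρ n : Measure unitInterval))
      atTop (𝓝 l) := by
    intro a
    have hre : 0 < ((a : ℝ) + 1 : ℂ).re := by
      simp only [Complex.add_re, Complex.ofReal_re, Complex.one_re]
      positivity
    refine ⟨(φ ((a : ℝ) + 1)).re,
      tendsto_integral_realResolvent (z := ⟨(a : ℝ) + 1, Or.inl hre⟩) rfl ?_⟩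
    simpa only [hρ, integral_slitResolvent_compactify (hσsupp _)] using hpt _ hre
  obtain ⟨C, hC⟩ : ∃ C, ∀ n, (ρ n : Measure unitInterval).real univ ≤ C := by
    obtain ⟨l, hl⟩ := hres 0
    obtain ⟨C, hC⟩ := hl.bddAbove_range
    refine ⟨C, fun n => ?_⟩
    simpa [realResolvent_apply] using hC (mem_range_self n)
  obtain ⟨ρ', hρ'⟩ := exists_weakLimit_of_realResolvent ρ hC hres
  have hsupp' := decompactify_Iio_zero (ρ' : Measure unitInterval)
  refine ⟨(ρ' : Measure unitInterval).real {0}, decompactify ρ', measureReal_nonneg, hsupp', ?_⟩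
  simp only [restrict_Ici_zero_of_measure_Iio_zero hsupp']
  refine ⟨lintegral_decompactify_lt_top _, fun z hz => ?_, fun g hg hc => ?_, fun K hK hKc => ?_⟩
  · rw [← integral_slitResolvent_eq (ρ' : Measure unitInterval) ⟨z, Or.inl hz⟩]
    refine tendsto_nhds_unique (hpt z hz) ((tendsto_integral_of_tendsto hρ'
      (slitResolvent ⟨z, Or.inl hz⟩)).congr fun n => ?_)
    exact integral_slitResolvent_compactify (hσsupp n) _
  · obtain ⟨f, hf, hf'⟩ := exists_continuousMap_integral_eq hg hc
    rw [hf']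
    exact (tendsto_integral_of_tendsto hρ' f).congr fun n => (hf _ (hσsupp n)).symm
  · have hKs : K ⊆ Complex.slitPlane := fun z hz => (hK hz).symm
    have : CompactSpace K := isCompact_iff_compactSpace.1 hKc
    rw [tendstoUniformlyOn_iff_tendstoUniformly_comp_coe]
    have hunif := tendstoUniformly_integral_of_tendsto hρ' hC
      (slitResolvent.comp ⟨inclusion hKs, continuous_inclusion hKs⟩)
    convert hunif using 1
    · ext n z
      exact (integral_slitResolvent_compactify (hσsupp n) (inclusion hKs z)).symm
    · ext z
      exact (integral_slitResolvent_eq (ρ' : Measure unitInterval) (inclusion hKs z)).symm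
end

section
/- The fixed point measure μ is absolutely continuous with respect to Lebesgue measure, and it admits a density 𝒟 : (0,1) → [0,∞) with respect to Lebesgue measure on (0,1) that is nondecreasing and convex on (0,1). -/
open MeasureTheory Set

namespace FixedPointMeasure

open Filter Topology

/-- The rational map whose iterates approximate the reciprocal Mellin transform of `μ`. -/
noncomputable def psi (x : ℝ) : ℝ := x - x⁻¹

/-- The positive solution `x` of `psi x = c`. -/
noncomputable def psiInv (c : ℝ) : ℝ := (c + √(c ^ 2 + 4)) / 2

lemma abs_lt_sqrt_sq_add_four (c : ℝ) : |c| < √(c ^ 2 + 4) :=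
  Real.lt_sqrt_of_sq_lt (by rw [sq_abs]; linarith)

lemma psiInv_pos (c : ℝ) : 0 < psiInv c := by
  have := abs_lt_sqrt_sq_add_four c
  have := neg_abs_le c
  unfold psiInv
  linarith

lemma psiInv_sq (c : ℝ) : psiInv c ^ 2 = c * psiInv c + 1 := by
  have := Real.sq_sqrt (show (0 : ℝ) ≤ c ^ 2 + 4 by positivity)
  unfold psiInv
  nlinarith

lemma psiInv_eq (c : ℝ) : psiInv c = c + (psiInv c)⁻¹ := by
  have h := psiInv_pos c
  have := psiInv_sq c
  field_simp
  linarith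

lemma psi_psiInv (c : ℝ) : psi (psiInv c) = c := by
  have := psiInv_eq c
  unfold psi
  linarith

lemma psi_strictMonoOn : StrictMonoOn psi (Ioi 0) := by
  intro x hx y _ hxy
  have := inv_strictAnti₀ (show 0 < x from hx) hxy
  unfold psi
  linarith

lemma psiInv_strictMono : StrictMono psiInv := by
  intro a b hab
  by_contra! h
  have := psi_strictMonoOn.monotoneOn (psiInv_pos b) (psiInv_pos a) h
  rw [psi_psiInv, psi_psiInv] at this
  linarith

/-- The reciprocals of the fixed point sequence, shifted by one and started at `0`. -/
noncomputable def node (n : ℕ) : ℝ := psiInv^[n] 0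

lemma node_zero : node 0 = 0 := rfl

lemma node_succ (n : ℕ) : node (n + 1) = psiInv (node n) :=
  Function.iterate_succ_apply' _ _ _

lemma node_succ_pos (n : ℕ) : 0 < node (n + 1) := by
  rw [node_succ]; exact psiInv_pos _

lemma node_nonneg : ∀ n, 0 ≤ node n
  | 0 => le_of_eq node_zero.symm
  | n + 1 => (node_succ_pos n).le

lemma node_succ_eq (n : ℕ) : node (n + 1) = node n + (node (n + 1))⁻¹ := by
  rw [node_succ]; exact psiInv_eq _

lemma psi_node_succ (n : ℕ) : psi (node (n + 1)) = node n := by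
  rw [node_succ, psi_psiInv]

lemma node_strictMono : StrictMono node :=
  strictMono_nat_of_lt_succ fun n => by
    have := inv_pos.2 (node_succ_pos n)
    linarith [node_succ_eq n]

lemma node_one : node 1 = 1 := by
  rw [node_succ, node_zero, psiInv]
  have : √((0 : ℝ) ^ 2 + 4) = 2 := by
    rw [show (0 : ℝ) ^ 2 + 4 = 2 ^ 2 by norm_num]
    exact Real.sqrt_sq (by norm_num)
  rw [this]; norm_num

lemma le_node_sq (n : ℕ) : (n : ℝ) ≤ node n ^ 2 := by
  induction n with
  | zero => simp [node_zero]
  | succ n ih =>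
    have h := psiInv_sq (node n)
    rw [← node_succ] at h
    have := (node_strictMono n.lt_succ_self).le
    have := node_nonneg n
    push_cast
    nlinarith

lemma fpSeq_eq_inv_node (n : ℕ) : fpSeq n = (node (n + 1))⁻¹ := by
  induction n with
  | zero => simp [fpSeq, node_one]
  | succ n ih =>
    have hT := node_succ_pos n
    rw [fpSeq, ih, node_succ (n + 1)]
    set T := node (n + 1)
    have hs : √(1 + 4 * T⁻¹ ^ 2) = √(T ^ 2 + 4) / T := by
      rw [show 1 + 4 * T⁻¹ ^ 2 = (T ^ 2 + 4) / T ^ 2 by field_simp,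
        Real.sqrt_div (by positivity), Real.sqrt_sq hT.le]
    have h := Real.sq_sqrt (show (0 : ℝ) ≤ T ^ 2 + 4 by positivity)
    have hp := psiInv_pos T
    rw [hs]
    refine eq_inv_of_mul_eq_one_left ?_
    unfold psiInv
    field_simp
    nlinarith

lemma psi_iterate_node (N k : ℕ) : psi^[N] (node (N + k)) = node k := by
  induction N with
  | zero => simp
  | succ N ih => rw [Function.iterate_succ_apply, show N + 1 + k = N + k + 1 by ring,
      psi_node_succ, ih]

lemma abs_psi_iterate_sub_le (N : ℕ) : ∀ {x y : ℝ}, node (N + 1) ≤ x → node (N + 1) ≤ y →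
    |psi^[N] x - psi^[N] y| ≤ node (N + 1) * |x - y| := by
  induction N with
  | zero => intro x y _ _; simp [node_one]
  | succ N ih =>
    intro x y hx hy
    set T := node (N + 1)
    set T' := node (N + 1 + 1)
    have hT : 0 < T := node_succ_pos N
    have hT' : 0 < T' := node_succ_pos (N + 1)
    have hx0 : 0 < x := hT'.trans_le hx
    have hy0 : 0 < y := hT'.trans_le hy
    have hpsi : ∀ z, T' ≤ z → T ≤ psi z := fun z hz => by
      rw [show T = psi T' from (psi_node_succ (N + 1)).symm]
      exact psi_strictMonoOn.monotoneOn hT' (hT'.trans_le hz) hz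
    have hrec : T' ^ 2 = T * T' + 1 := by
      have := psiInv_sq T; rwa [← node_succ] at this
    rw [Function.iterate_succ_apply, Function.iterate_succ_apply]
    refine (ih (hpsi x hx) (hpsi y hy)).trans ?_
    have hd : psi x - psi y = (x - y) * (1 + (x * y)⁻¹) := by
      unfold psi; field_simp; ring
    rw [hd, abs_mul, abs_of_pos (show 0 < 1 + (x * y)⁻¹ by positivity)]
    have hxy : (x * y)⁻¹ ≤ (T' ^ 2)⁻¹ := by
      apply inv_anti₀ (by positivity); nlinarith
    have hmul : T * (1 + (x * y)⁻¹) ≤ T' := by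
      have h1 : T * (1 + (x * y)⁻¹) ≤ T * (1 + (T' ^ 2)⁻¹) := by gcongr
      have h2 : T * (1 + (T' ^ 2)⁻¹) ≤ T' := by
        have hTT : T * T' = T' ^ 2 - 1 := by linarith
        have : T * (1 + (T' ^ 2)⁻¹) = T' - T' ^ (-3 : ℤ) := by
          have : T = (T' ^ 2 - 1) / T' := by field_simp; linarith
          rw [this]; field_simp; ring
        rw [this]
        have : 0 < T' ^ (-3 : ℤ) := by positivity
        linarith
      linarith
    calc T * (|x - y| * (1 + (x * y)⁻¹)) = T * (1 + (x * y)⁻¹) * |x - y| := by ring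
      _ ≤ T' * |x - y| := by gcongr

/-- The point at which `psi^[N]` approximates the reciprocal of the `k`-th moment. -/
noncomputable def samplePoint (N k : ℕ) : ℝ := node (N + 1) + k * (node (N + 1))⁻¹

lemma node_le_samplePoint (N k : ℕ) : node (N + 1 + k) ≤ samplePoint N k := by
  unfold samplePoint
  induction k with
  | zero => simp
  | succ k ih =>
    have h := node_succ_eq (N + 1 + k)
    have : (node (N + 1 + k + 1))⁻¹ ≤ (node (N + 1))⁻¹ :=
      inv_anti₀ (node_succ_pos N) (node_strictMono.monotone (by omega))
    rw [← add_assoc]; push_cast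
    linarith

lemma le_node_add (N k : ℕ) :
    node (N + 1) + k * (node (N + 1 + k))⁻¹ ≤ node (N + 1 + k) := by
  induction k with
  | zero => simp
  | succ k ih =>
    have h := node_succ_eq (N + 1 + k)
    have : (node (N + 1 + k + 1))⁻¹ ≤ (node (N + 1 + k))⁻¹ := by
      refine inv_anti₀ ?_ (node_strictMono.monotone (by omega))
      rw [show N + 1 + k = N + k + 1 by ring]; exact node_succ_pos _
    have := mul_le_mul_of_nonneg_left this (Nat.cast_nonneg (α := ℝ) k)
    rw [← add_assoc]; push_cast
    linarith

lemma abs_psi_iterate_samplePoint_sub_le (N k : ℕ) :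
    |psi^[N] (samplePoint N k) - node (k + 1)| ≤ k ^ 2 * ((N : ℝ) + 1)⁻¹ := by
  have hT := node_succ_pos N
  have hle : node (N + 1) ≤ node (N + 1 + k) := node_strictMono.monotone (by omega)
  have h1 := node_le_samplePoint N k
  have h2 := le_node_add N k
  have h3 := abs_psi_iterate_sub_le N (hle.trans h1) hle
  rw [show psi^[N] (node (N + 1 + k)) = node (k + 1) by
    rw [show N + 1 + k = N + (k + 1) by ring, psi_iterate_node]] at h3
  refine h3.trans ?_
  rw [abs_of_nonneg (sub_nonneg.2 h1)]
  have hsq := le_node_sq (N + 1)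
  push_cast at hsq
  unfold samplePoint at *
  set T := node (N + 1)
  set T' := node (N + 1 + k)
  have hT' : 0 < T' := hT.trans_le hle
  have h4 : T' - T ≤ k * T⁻¹ := by linarith
  have h5 : T⁻¹ - T'⁻¹ ≤ k * (T ^ 3)⁻¹ := by
    have : T⁻¹ - T'⁻¹ = (T' - T) * (T⁻¹ * T'⁻¹) := by field_simp
    rw [this]
    calc (T' - T) * (T⁻¹ * T'⁻¹) ≤ (k * T⁻¹) * (T⁻¹ * T⁻¹) := by gcongr
      _ = k * (T ^ 3)⁻¹ := by field_simp
  calc T * (T + k * T⁻¹ - T') ≤ T * (k * (T⁻¹ - T'⁻¹)) := by gcongr; linarith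
    _ ≤ T * (k * (k * (T ^ 3)⁻¹)) := by gcongr
    _ = k ^ 2 * (T ^ 2)⁻¹ := by field_simp
    _ ≤ k ^ 2 * ((N : ℝ) + 1)⁻¹ := by gcongr

lemma tendsto_inv_psi_iterate_samplePoint (k : ℕ) :
    Tendsto (fun N => (psi^[N] (samplePoint N k))⁻¹) atTop (𝓝 (fpSeq k)) := by
  rw [fpSeq_eq_inv_node]
  refine Tendsto.inv₀ ?_ (node_succ_pos k).ne'
  rw [tendsto_iff_dist_tendsto_zero]
  refine squeeze_zero (fun _ => dist_nonneg)
    (fun N => abs_psi_iterate_samplePoint_sub_le N k) ?_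
  have := (tendsto_one_div_add_atTop_nhds_zero_nat (𝕜 := ℝ)).const_mul ((k : ℝ) ^ 2)
  simpa using this

lemma inv_psi_sub (c : ℝ) {x : ℝ} (hx : psiInv c < x) :
    (psi x - c)⁻¹ = psiInv c / (psiInv c + (psiInv c)⁻¹) * (x - psiInv c)⁻¹
      + (psiInv c)⁻¹ / (psiInv c + (psiInv c)⁻¹) * (x - -(psiInv c)⁻¹)⁻¹ := by
  have hp := psiInv_pos c
  have hx0 : 0 < x := hp.trans hx
  have hc : c = psi (psiInv c) := (psi_psiInv c).symm
  set p := psiInv c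
  rw [hc]
  have h1 : psi x - psi p = (x - p) * (x + p⁻¹) / x := by
    unfold psi; field_simp; ring
  have h2 : x - p ≠ 0 := (sub_pos.2 hx).ne'
  have h3 : x * p + 1 ≠ 0 := by positivity
  have h4 : p ^ 2 + 1 ≠ 0 := by positivity
  rw [h1, sub_neg_eq_add]
  field_simp
  ring

/-- Partial fraction expansion of the reciprocal of `psi^[N + 1]`, with positive residues and
with all poles but the largest one below `node N`. -/
lemma exists_partialFraction (N : ℕ) : ∃ (n : ℕ) (r p : Fin n → ℝ), (∀ i, 0 < r i) ∧
    (∀ i, p i = node (N + 1) ∨ p i < node N) ∧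
    ∀ x, node (N + 1) < x → (psi^[N + 1] x)⁻¹ = ∑ i, r i * (x - p i)⁻¹ := by
  induction N with
  | zero =>
    refine ⟨2, ![1 / 2, 1 / 2], ![1, -1], ?_, ?_, ?_⟩
    · intro i; fin_cases i <;> norm_num
    · intro i; fin_cases i <;> norm_num [node_one, node_zero]
    · intro x hx
      have := inv_psi_sub 0 (x := x) (by rwa [← node_zero, ← node_succ])
      rw [← node_zero, ← node_succ, zero_add, node_one, node_zero] at this
      norm_num at this
      simpa [Fin.sum_univ_two] using this
  | succ N ih =>
    obtain ⟨n, r, p, hr, hp, h⟩ := ih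
    let q : Fin n → ℝ := fun i => psiInv (p i)
    have hq : ∀ i, 0 < q i := fun i => psiInv_pos _
    refine ⟨n + n, Fin.append (fun i => r i * (q i / (q i + (q i)⁻¹)))
      (fun i => r i * ((q i)⁻¹ / (q i + (q i)⁻¹))), Fin.append q (fun i => -(q i)⁻¹), ?_, ?_, ?_⟩
    · intro i
      refine Fin.addCases (fun i => ?_) (fun i => ?_) i
      all_goals
        have := hq i
        have := hr i
        simp only [Fin.append_left, Fin.append_right]
        positivity
    · intro i
      refine Fin.addCases (fun i => ?_) (fun i => ?_) i
      · simp only [Fin.append_left]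
        rcases hp i with h | h
        · left; rw [node_succ (N + 1), ← h]
        · right; rw [node_succ N]; exact psiInv_strictMono h
      · simp only [Fin.append_right]
        right
        have := inv_pos.2 (hq i)
        linarith [node_nonneg (N + 1)]
    · intro x hx
      have hx' : node (N + 1) < psi x := by
        rw [← psi_node_succ (N + 1)]
        exact psi_strictMonoOn (node_succ_pos _) ((node_succ_pos _).trans hx) hx
      rw [Function.iterate_succ_apply, h _ hx', Fin.sum_univ_add, ← Finset.sum_add_distrib]
      refine Finset.sum_congr rfl fun i _ => ?_
      simp only [Fin.append_left, Fin.append_right]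
      rw [inv_psi_sub (p i) (x := x)]
      · ring
      · refine lt_of_le_of_lt ?_ hx
        rw [node_succ (N + 1)]
        refine psiInv_strictMono.monotone ?_
        rcases hp i with h | h
        · exact h.le
        · exact (h.trans (node_strictMono N.lt_succ_self)).le

lemma intervalIntegral_pow_mul_rpow (k : ℕ) {b : ℝ} (hb : 0 ≤ b) :
    ∫ t in (0 : ℝ)..1, t ^ k * t ^ b = (k + (b + 1))⁻¹ := by
  have h : ∫ t in (0 : ℝ)..1, t ^ k * t ^ b = ∫ t in (0 : ℝ)..1, t ^ (k + b) := by
    refine intervalIntegral.integral_congr_ae (.of_forall fun t ht => ?_)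
    rw [uIoc_of_le zero_le_one] at ht
    simp only [Real.rpow_add ht.1, Real.rpow_natCast]
  have hk : (0 : ℝ) ≤ k := Nat.cast_nonneg k
  rw [h, integral_rpow (Or.inl (by linarith)), Real.one_rpow,
    Real.zero_rpow (by positivity), sub_zero, one_div, add_assoc]

lemma exists_approx_density (N : ℕ) : ∃ D : ℝ → ℝ, Continuous D ∧
    (∀ t ∈ Icc (0 : ℝ) 1, 0 ≤ D t) ∧ MonotoneOn D (Icc 0 1) ∧ ConvexOn ℝ (Icc 0 1) D ∧
    ∀ k : ℕ, ∫ t in (0 : ℝ)..1, t ^ k * D t = (psi^[N + 1] (samplePoint (N + 1) k))⁻¹ := by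
  obtain ⟨n, r, p, hr, hp, h⟩ := exists_partialFraction N
  set T := node (N + 1 + 1) with hTdef
  have hT : 0 < T := node_succ_pos _
  have h1 : T = node (N + 1) + T⁻¹ := node_succ_eq (N + 1)
  have h1' : T * (T - node (N + 1)) = 1 := by
    rw [show T - node (N + 1) = T⁻¹ by linarith, mul_inv_cancel₀ hT.ne']
  have h2 : 2 ≤ T * (T - node N) := by
    have e := node_succ_eq N
    have : T⁻¹ ≤ (node (N + 1))⁻¹ :=
      inv_anti₀ (node_succ_pos N) (node_strictMono (Nat.lt_succ_self _)).le
    have : 2 * T⁻¹ ≤ T - node N := by linarith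
    calc (2 : ℝ) = T * (2 * T⁻¹) := by field_simp
      _ ≤ _ := by gcongr
  let b : Fin n → ℝ := fun i => T * (T - p i) - 1
  have hb : ∀ i, b i = 0 ∨ 1 ≤ b i := fun i => by
    rcases hp i with hi | hi
    · left; simp only [b]; rw [hi, h1']; norm_num
    · right
      have : T * (T - node N) ≤ T * (T - p i) := by gcongr
      simp only [b]; linarith
  have hb0 : ∀ i, 0 ≤ b i := fun i => by rcases hb i with h | h <;> linarith
  have hc : ∀ i, 0 ≤ r i * T := fun i => (mul_pos (hr i) hT).le
  have hcont : ∀ i, Continuous fun t : ℝ => t ^ b i := fun i =>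
    Real.continuous_rpow_const (hb0 i)
  refine ⟨fun t => ∑ i, r i * T * t ^ b i, ?_, ?_, ?_, ?_, ?_⟩
  · exact continuous_finsetSum _ fun i _ => (hcont i).const_mul _
  · intro t ht
    exact Finset.sum_nonneg fun i _ => mul_nonneg (hc i) (Real.rpow_nonneg ht.1 _)
  · intro s hs t _ hst
    exact Finset.sum_le_sum fun i _ =>
      mul_le_mul_of_nonneg_left (Real.rpow_le_rpow hs.1 hst (hb0 i)) (hc i)
  · have hi : ∀ i, ConvexOn ℝ (Icc (0 : ℝ) 1) fun t : ℝ => t ^ b i := fun i => by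
      rcases hb i with h | h
      · simpa [h] using convexOn_const (1 : ℝ) (convex_Icc (0 : ℝ) 1)
      · exact (convexOn_rpow h).subset Icc_subset_Ici_self (convex_Icc _ _)
    refine ⟨convex_Icc _ _, fun x hx y hy u v hu hv huv => ?_⟩
    simp only [Finset.smul_sum, ← Finset.sum_add_distrib]
    refine Finset.sum_le_sum fun i _ => ?_
    have := mul_le_mul_of_nonneg_left ((hi i).2 hx hy hu hv huv) (hc i)
    simp only [smul_eq_mul] at this ⊢
    linarith
  · intro k
    have hk : (0 : ℝ) ≤ k := Nat.cast_nonneg k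
    have hx : node (N + 1) < samplePoint (N + 1) k :=
      (node_strictMono (Nat.lt_succ_self _)).trans_le
        (le_add_of_nonneg_right (mul_nonneg hk (inv_pos.2 hT).le))
    rw [h _ hx]
    simp only [Finset.mul_sum]
    have hi : ∀ i, IntervalIntegrable (fun t : ℝ => t ^ k * (r i * T * t ^ b i)) volume 0 1 :=
      fun i => ((continuous_pow k).mul ((hcont i).const_mul _)).intervalIntegrable 0 1
    rw [intervalIntegral.integral_finsetSum fun i _ => hi i]
    refine Finset.sum_congr rfl fun i _ => ?_
    have : ∀ t : ℝ, t ^ k * (r i * T * t ^ b i) = r i * T * (t ^ k * t ^ b i) :=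
      fun t => by ring
    simp only [this, intervalIntegral.integral_const_mul]
    rw [intervalIntegral_pow_mul_rpow k (hb0 i), mul_assoc]
    congr 1
    have e : samplePoint (N + 1) k - p i = (k + (b i + 1)) / T := by
      simp only [samplePoint, b, ← hTdef]; field_simp; ring
    rw [e, inv_div, div_eq_mul_inv]

lemma le_inv_of_intervalIntegral_eq_one {D : ℝ → ℝ} (hD : Continuous D)
    (hnn : ∀ t ∈ Icc (0 : ℝ) 1, 0 ≤ D t) (hmono : MonotoneOn D (Icc 0 1))
    (hint : ∫ t in (0 : ℝ)..1, D t = 1) {t : ℝ} (ht : t ∈ Ioo (0 : ℝ) 1) :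
    D t ≤ (1 - t)⁻¹ := by
  have h1 : (1 - t) * D t ≤ ∫ s in t..1, D s := by
    have := intervalIntegral.integral_mono_on (μ := volume) (f := fun _ => D t) (g := D)
      ht.2.le intervalIntegrable_const (hD.intervalIntegrable t 1)
      (fun s hs => hmono ⟨ht.1.le, ht.2.le⟩ ⟨ht.1.le.trans hs.1, hs.2⟩ hs.1)
    simpa using this
  have h2 : 0 ≤ ∫ s in (0 : ℝ)..t, D s :=
    intervalIntegral.integral_nonneg ht.1.le fun s hs => hnn s ⟨hs.1, hs.2.trans ht.2.le⟩
  have h3 := intervalIntegral.integral_add_adjacent_intervals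
    (hD.intervalIntegrable (μ := volume) 0 t) (hD.intervalIntegrable t 1)
  rw [← one_div, le_div_iff₀ (sub_pos.2 ht.2)]
  linarith

/-- Selection theorem for nondecreasing convex functions. -/
lemma exists_subseq_tendsto_of_convexOn {D : ℕ → ℝ → ℝ} {B : ℝ → ℝ}
    (hnn : ∀ n, ∀ t ∈ Ioo (0 : ℝ) 1, 0 ≤ D n t)
    (hB : ∀ n, ∀ t ∈ Ioo (0 : ℝ) 1, D n t ≤ B t)
    (hmono : ∀ n, MonotoneOn (D n) (Ioo 0 1)) (hconv : ∀ n, ConvexOn ℝ (Ioo 0 1) (D n)) :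
    ∃ φ : ℕ → ℕ, StrictMono φ ∧ ∃ E : ℝ → ℝ, ∀ t ∈ Ioo (0 : ℝ) 1,
      Tendsto (fun n => D (φ n) t) atTop (𝓝 (E t)) := by
  let Q := {q : ℚ // (q : ℝ) ∈ Ioo (0 : ℝ) 1}
  have hK : IsCompact (Set.pi univ fun q : Q => Icc 0 (B (q : ℚ))) :=
    isCompact_univ_pi fun _ => isCompact_Icc
  obtain ⟨a, -, φ, hφ, ha⟩ := hK.tendsto_subseq (x := fun n (q : Q) => D n (q : ℚ))
    fun n q _ => ⟨hnn n _ q.2, hB n _ q.2⟩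
  rw [tendsto_pi_nhds] at ha
  refine ⟨φ, hφ, ?_⟩
  have key : ∀ t ∈ Ioo (0 : ℝ) 1, ∃ e, Tendsto (fun n => D (φ n) t) atTop (𝓝 e) := by
    intro t ht
    refine cauchySeq_tendsto_of_complete (Metric.cauchySeq_iff'.2 fun ε hε => ?_)
    obtain ⟨r, htr, hr1⟩ := exists_between ht.2
    obtain ⟨m, htm, hmr⟩ := exists_between htr
    have hr : r ∈ Ioo (0 : ℝ) 1 := ⟨ht.1.trans htr, hr1⟩
    set C := B r / (r - m)
    have hrm : 0 < r - m := sub_pos.2 hmr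
    have hC : 0 ≤ C := div_nonneg ((hnn 0 r hr).trans (hB 0 r hr)) hrm.le
    obtain ⟨q, htq, hq⟩ := exists_rat_btwn
      (show t < min m (t + ε / (3 * (C + 1))) from lt_min htm (by
        have : 0 < ε / (3 * (C + 1)) := by positivity
        linarith))
    have hqm : (q : ℝ) < m := hq.trans_le (min_le_left _ _)
    have hqr : (q : ℝ) < r := hqm.trans hmr
    have hqI : (q : ℝ) ∈ Ioo (0 : ℝ) 1 := ⟨ht.1.trans htq, hqr.trans hr1⟩
    have hqt : C * (q - t) < ε / 3 := by
      have h1 : (q : ℝ) - t < ε / (3 * (C + 1)) := by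
        linarith [hq.trans_le (min_le_right _ _)]
      rw [lt_div_iff₀ (by positivity)] at h1
      nlinarith [sub_pos.2 htq]
    have hclose : ∀ n, |D n t - D n q| < ε / 3 := fun n => by
      have h1 := hmono n ht hqI htq.le
      have h2 := (hconv n).slope_mono_adjacent ht hr htq hqr
      have h3 : (D n r - D n q) / (r - q) ≤ C :=
        div_le_div₀ ((hnn 0 r hr).trans (hB 0 r hr))
          (by linarith [hB n r hr, hnn n _ hqI]) hrm (by linarith)
      have h4 := (div_le_iff₀ (sub_pos.2 htq)).1 (h2.trans h3)
      rw [abs_sub_comm, abs_of_nonneg (sub_nonneg.2 h1)]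
      linarith
    obtain ⟨N, hN⟩ := Metric.cauchySeq_iff'.1 (ha ⟨q, hqI⟩).cauchySeq (ε / 3) (by positivity)
    refine ⟨N, fun n hn => ?_⟩
    have h1 := hN n hn
    have h2 := hclose (φ n)
    have h3 := hclose (φ N)
    simp only [Real.dist_eq, Function.comp_apply] at h1 ⊢
    rw [abs_lt] at *
    constructor <;> linarith
  choose! E hE using key
  exact ⟨E, hE⟩

/-- Finite measures on `[0, 1]` are determined by their moments. -/
lemma ext_of_forall_integral_pow_eq {μ ν : Measure ℝ} [IsFiniteMeasure μ] [IsFiniteMeasure ν]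
    (hμ : ∀ᵐ t ∂μ, t ∈ Icc (0 : ℝ) 1) (hν : ∀ᵐ t ∂ν, t ∈ Icc (0 : ℝ) 1)
    (h : ∀ k : ℕ, ∫ t, t ^ k ∂μ = ∫ t, t ^ k ∂ν) : μ = ν := by
  have hint : ∀ {m : Measure ℝ} [IsFiniteMeasure m], (∀ᵐ t ∂m, t ∈ Icc (0 : ℝ) 1) →
      ∀ k : ℕ, Integrable (fun t : ℝ => t ^ k) m := fun hm k =>
    Integrable.of_bound (by fun_prop) 1 (hm.mono fun t ht => by
      rw [Real.norm_of_nonneg (pow_nonneg ht.1 k)]; exact pow_le_one₀ ht.1 ht.2)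
  have hpint : ∀ {m : Measure ℝ} [IsFiniteMeasure m], (∀ᵐ t ∂m, t ∈ Icc (0 : ℝ) 1) →
      ∀ p : Polynomial ℝ, Integrable (fun t => p.eval t) m := fun hm p => by
    simp only [Polynomial.eval_eq_sum_range]
    exact integrable_finsetSum _ fun k _ => (hint hm k).const_mul _
  have hpoly : ∀ p : Polynomial ℝ, ∫ t, p.eval t ∂μ = ∫ t, p.eval t ∂ν := fun p => by
    simp only [Polynomial.eval_eq_sum_range]
    rw [integral_finsetSum _ fun k _ => (hint hμ k).const_mul _,
      integral_finsetSum _ fun k _ => (hint hν k).const_mul _]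
    simp only [integral_const_mul, h]
  refine ext_of_forall_integral_eq_of_IsFiniteMeasure fun f => ?_
  have happrox : ∀ {m : Measure ℝ} [IsFiniteMeasure m], (∀ᵐ t ∂m, t ∈ Icc (0 : ℝ) 1) →
      ∀ (p : Polynomial ℝ) (ε : ℝ), (∀ t ∈ Icc (0 : ℝ) 1, |p.eval t - f t| < ε) →
      |∫ t, p.eval t ∂m - ∫ t, f t ∂m| ≤ ε * m.real univ := fun {m} _ hm p ε hp => by
    rw [← integral_sub (hpint hm p) (f.integrable m)]
    exact norm_integral_le_of_norm_le_const (f := fun t => p.eval t - f t)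
      (hm.mono fun t ht => (hp t ht).le)
  refine eq_of_forall_dist_le fun ε hε => ?_
  set M := μ.real univ + ν.real univ + 1
  have hM : 0 < M := by positivity
  obtain ⟨p, hp⟩ := exists_polynomial_near_of_continuousOn 0 1 f f.continuous.continuousOn
    (ε / M) (by positivity)
  have h1 := happrox hμ p _ hp
  have h2 := happrox hν p _ hp
  rw [hpoly p] at h1
  have h3 : ε / M * μ.real univ + ε / M * ν.real univ ≤ ε := by
    rw [← mul_add, div_mul_eq_mul_div, div_le_iff₀ hM]
    exact mul_le_mul_of_nonneg_left (by simp only [M]; linarith) hε.le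
  rw [Real.dist_eq]
  rw [abs_le] at *
  constructor <;> linarith

/-- Two measures carried by `(-∞, 1)` agree once they agree after weighting by `1 - t`. -/
lemma eq_of_withDensity_one_sub_eq {μ ν : Measure ℝ}
    (hμ : ∀ᵐ t ∂μ, t < 1) (hν : ∀ᵐ t ∂ν, t < 1)
    (h : μ.withDensity (fun t => ENNReal.ofReal (1 - t)) =
      ν.withDensity fun t => ENNReal.ofReal (1 - t)) : μ = ν := by
  have hm : Measurable fun t : ℝ => ENNReal.ofReal (1 - t) := by fun_prop
  have hne : ∀ t : ℝ, t < 1 → ENNReal.ofReal (1 - t) ≠ 0 := fun t ht => by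
    simpa using ht
  rw [← withDensity_inv_same hm (hμ.mono hne) (.of_forall fun _ => ENNReal.ofReal_ne_top), h,
    withDensity_inv_same hm (hν.mono hne) (.of_forall fun _ => ENNReal.ofReal_ne_top)]

lemma tendsto_fpSeq : Tendsto fpSeq atTop (𝓝 0) := by
  have h : Tendsto (fun n : ℕ => √((n : ℝ) + 1)) atTop atTop :=
    Real.tendsto_sqrt_atTop.comp
      (tendsto_atTop_add_const_right _ 1 tendsto_natCast_atTop_atTop)
  refine squeeze_zero (fun n => ?_) (fun n => ?_) h.inv_tendsto_atTop
  · rw [fpSeq_eq_inv_node]; exact (inv_pos.2 (node_succ_pos n)).le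
  · rw [fpSeq_eq_inv_node]
    refine inv_anti₀ (by positivity) (Real.sqrt_le_left (node_nonneg _) |>.2 ?_)
    exact_mod_cast le_node_sq (n + 1)

lemma exists_limit_density : ∃ D : ℝ → ℝ,
    (∀ t ∈ Ioo (0 : ℝ) 1, 0 ≤ D t) ∧ (∀ t ∈ Ioo (0 : ℝ) 1, D t ≤ (1 - t)⁻¹) ∧
    MonotoneOn D (Ioo 0 1) ∧ ConvexOn ℝ (Ioo 0 1) D ∧
    ∀ k : ℕ, ∫ t in Ioo (0 : ℝ) 1, (1 - t) * D t * t ^ k = fpSeq k - fpSeq (k + 1) := by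
  choose A hcont hnn hmono hconv hmom using exists_approx_density
  have hsub : Ioo (0 : ℝ) 1 ⊆ Icc 0 1 := Ioo_subset_Icc_self
  have hone : ∀ N, ∫ t in (0 : ℝ)..1, A N t = 1 := fun N => by
    have := hmom N 0
    simp only [pow_zero, one_mul] at this
    rw [this, samplePoint, Nat.cast_zero, zero_mul, add_zero, psi_iterate_node (N + 1) 1,
      node_one, inv_one]
  have hB : ∀ N, ∀ t ∈ Ioo (0 : ℝ) 1, A N t ≤ (1 - t)⁻¹ := fun N t ht =>
    le_inv_of_intervalIntegral_eq_one (hcont N) (hnn N) (hmono N) (hone N) ht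
  obtain ⟨φ, hφ, D, hD⟩ := exists_subseq_tendsto_of_convexOn (D := A)
    (fun N t ht => hnn N t (hsub ht)) hB (fun N => (hmono N).mono hsub)
    (fun N => (hconv N).subset hsub (convex_Ioo _ _))
  refine ⟨D, fun t ht => ?_, fun t ht => ?_, fun s hs t ht hst => ?_,
    ⟨convex_Ioo _ _, fun x hx y hy a b ha hb hab => ?_⟩, fun k => ?_⟩
  · exact ge_of_tendsto' (hD t ht) fun n => hnn _ t (hsub ht)
  · exact le_of_tendsto' (hD t ht) fun n => hB _ t ht
  · exact le_of_tendsto_of_tendsto' (hD s hs) (hD t ht) fun n =>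
      hmono _ (hsub hs) (hsub ht) hst
  · exact le_of_tendsto_of_tendsto' (hD _ (convex_Ioo (0 : ℝ) 1 hx hy ha hb hab))
      (((hD x hx).const_smul a).add ((hD y hy).const_smul b)) fun n =>
        (hconv _).2 (hsub hx) (hsub hy) ha hb hab
  · have hval : ∀ N, ∫ t in Ioo (0 : ℝ) 1, (1 - t) * A N t * t ^ k =
        (psi^[N + 1] (samplePoint (N + 1) k))⁻¹ -
          (psi^[N + 1] (samplePoint (N + 1) (k + 1)))⁻¹ := fun N => by
      have hi : ∀ j : ℕ, IntervalIntegrable (fun t => t ^ j * A N t) volume 0 1 := fun j =>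
        ((continuous_pow j).mul (hcont N)).intervalIntegrable 0 1
      rw [← hmom, ← hmom, ← intervalIntegral.integral_sub (hi _) (hi _),
        intervalIntegral.integral_of_le zero_le_one, integral_Ioc_eq_integral_Ioo]
      congr 1 with t
      ring
    have hlim : Tendsto (fun n => ∫ t in Ioo (0 : ℝ) 1, (1 - t) * A (φ n) t * t ^ k) atTop
        (𝓝 (∫ t in Ioo (0 : ℝ) 1, (1 - t) * D t * t ^ k)) := by
      refine tendsto_integral_of_dominated_convergence (fun _ => 1)
        (fun n => ?_) (integrable_const _) (fun n => ?_) ?_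
      · have := hcont (φ n)
        fun_prop
      · refine (ae_restrict_mem measurableSet_Ioo).mono fun t ht => ?_
        have h0 : 0 ≤ 1 - t := by linarith [ht.2]
        have h1 : 0 ≤ A (φ n) t := hnn _ t (hsub ht)
        rw [Real.norm_of_nonneg (mul_nonneg (mul_nonneg h0 h1) (pow_nonneg ht.1.le k))]
        refine mul_le_one₀ ?_ (pow_nonneg ht.1.le k) (pow_le_one₀ ht.1.le ht.2.le)
        calc (1 - t) * A (φ n) t ≤ (1 - t) * (1 - t)⁻¹ := by
              gcongr; exact hB _ t ht
          _ = 1 := mul_inv_cancel₀ (sub_pos.2 ht.2).ne'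
      · exact (ae_restrict_mem measurableSet_Ioo).mono fun t ht =>
          ((hD t ht).const_mul _).mul_const _
    refine tendsto_nhds_unique hlim ?_
    simp only [hval]
    have hs : Tendsto (fun n => φ n + 1) atTop atTop :=
      (tendsto_add_atTop_nat 1).comp hφ.tendsto_atTop
    exact ((tendsto_inv_psi_iterate_samplePoint k).comp hs).sub
      ((tendsto_inv_psi_iterate_samplePoint (k + 1)).comp hs)

lemma measure_singleton_one_eq_zero {μ : Measure ℝ} [IsFiniteMeasure μ]
    (hmom : ∀ n : ℕ, ∫ t in Set.Icc (0:ℝ) 1, t ^ n ∂μ = fpSeq n) : μ {1} = 0 := by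
  have h : ∀ n, μ.real {1} ≤ fpSeq n := fun n => by
    have hi : IntegrableOn (fun t : ℝ => t ^ n) (Icc 0 1) μ :=
      (continuous_pow n).continuousOn.integrableOn_compact isCompact_Icc
    rw [← hmom n]
    calc μ.real {1} = ∫ t in ({1} : Set ℝ), t ^ n ∂μ := by
          rw [integral_singleton]; simp
      _ ≤ _ := setIntegral_mono_set hi
          ((ae_restrict_mem measurableSet_Icc).mono fun t ht => pow_nonneg ht.1 n)
          (LE.le.eventuallyLE (by simp))
  have := ge_of_tendsto' tendsto_fpSeq h
  exact (measureReal_eq_zero_iff).1 (le_antisymm this measureReal_nonneg)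

end FixedPointMeasure

open FixedPointMeasure

theorem stmt_16 (μ : Measure ℝ) [IsProbabilityMeasure μ]
    (hsupp : μ (Set.Icc (0:ℝ) 1)ᶜ = 0) (h0 : μ {0} = 0)
    (hmom : ∀ n : ℕ, ∫ t in Set.Icc (0:ℝ) 1, t ^ n ∂μ = fpSeq n) :
    μ ≪ MeasureTheory.volume ∧
    ∃ D : ℝ → ℝ,
      (∀ t ∈ Set.Ioo (0:ℝ) 1, 0 ≤ D t) ∧
      MonotoneOn D (Set.Ioo (0:ℝ) 1) ∧
      ConvexOn ℝ (Set.Ioo (0:ℝ) 1) D ∧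
      μ = (MeasureTheory.volume.restrict (Set.Ioo (0:ℝ) 1)).withDensity
            (fun t => ENNReal.ofReal (D t)) := by
  obtain ⟨D, hnn, hB, hmono, hconv, hD⟩ := exists_limit_density
  suffices h : μ = (volume.restrict (Ioo (0 : ℝ) 1)).withDensity
      (fun t => ENNReal.ofReal (D t)) by
    refine ⟨?_, D, hnn, hmono, hconv, h⟩
    rw [h]
    exact (withDensity_absolutelyContinuous _ _).trans Measure.restrict_le_self.absolutelyContinuous
  have hμI : ∀ᵐ t ∂μ, t ∈ Icc (0 : ℝ) 1 := hsupp
  have hμ1 : ∀ᵐ t ∂μ, t ≠ 1 := by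
    rw [ae_iff]; simpa using measure_singleton_one_eq_zero hmom
  have hIoo : ∀ᵐ t ∂volume.restrict (Ioo (0 : ℝ) 1), t ∈ Ioo (0 : ℝ) 1 :=
    ae_restrict_mem measurableSet_Ioo
  have hDm : AEMeasurable D (volume.restrict (Ioo (0 : ℝ) 1)) :=
    aemeasurable_restrict_of_monotoneOn measurableSet_Ioo hmono
  have hac := withDensity_absolutelyContinuous (volume.restrict (Ioo (0 : ℝ) 1))
    fun t => ENNReal.ofReal (D t)
  refine eq_of_withDensity_one_sub_eq
    (by filter_upwards [hμI, hμ1] with t ht ht1 using lt_of_le_of_ne ht.2 ht1)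
    (hac.ae_le (hIoo.mono fun t ht => ht.2)) ?_
  have hmul : ((volume.restrict (Ioo (0 : ℝ) 1)).withDensity
      (fun t => ENNReal.ofReal (D t))).withDensity (fun t => ENNReal.ofReal (1 - t)) =
      (volume.restrict (Ioo (0 : ℝ) 1)).withDensity fun t => ENNReal.ofReal ((1 - t) * D t) := by
    rw [← withDensity_mul₀ hDm.ennreal_ofReal (by fun_prop)]
    refine withDensity_congr_ae (hIoo.mono fun t ht => ?_)
    simp only [Pi.mul_apply]
    rw [mul_comm, ENNReal.ofReal_mul (by linarith [ht.2])]
  rw [hmul]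
  have hint₁ : Integrable (fun t : ℝ => 1 - t) μ :=
    Integrable.of_bound (by fun_prop) 1 (hμI.mono fun t ht => by
      rw [Real.norm_of_nonneg (by linarith [ht.2])]; linarith [ht.1])
  have hint₂ : Integrable (fun t : ℝ => (1 - t) * D t) (volume.restrict (Ioo (0 : ℝ) 1)) := by
    refine Integrable.of_bound (by fun_prop) 1 (hIoo.mono fun t ht => ?_)
    have h0 : 0 < 1 - t := sub_pos.2 ht.2
    rw [Real.norm_of_nonneg (mul_nonneg h0.le (hnn t ht))]
    exact (mul_le_mul_of_nonneg_left (hB t ht) h0.le).trans_eq (mul_inv_cancel₀ h0.ne')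
  have := isFiniteMeasure_withDensity_ofReal hint₁.2
  have := isFiniteMeasure_withDensity_ofReal hint₂.2
  refine ext_of_forall_integral_pow_eq ?_ ?_ fun k => ?_
  · exact (withDensity_absolutelyContinuous _ _).ae_le hμI
  · exact (withDensity_absolutelyContinuous _ _).ae_le
      (hIoo.mono fun t ht => Ioo_subset_Icc_self ht)
  · rw [integral_withDensity_eq_integral_toReal_smul₀ (by fun_prop) (by simp),
      integral_withDensity_eq_integral_toReal_smul₀ (by fun_prop) (by simp)]
    have e₁ : ∫ t, (ENNReal.ofReal (1 - t)).toReal • t ^ k ∂μ =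
        fpSeq k - fpSeq (k + 1) := by
      have hi : ∀ j : ℕ, IntegrableOn (fun t : ℝ => t ^ j) (Icc 0 1) μ := fun j =>
        (continuous_pow j).continuousOn.integrableOn_compact isCompact_Icc
      rw [← hmom, ← hmom, ← integral_sub (hi _) (hi _), ← Measure.restrict_eq_self_of_ae_mem hμI]
      simp only [Measure.restrict_restrict measurableSet_Icc, inter_self]
      refine integral_congr_ae ((ae_restrict_mem measurableSet_Icc).mono fun t ht => ?_)
      simp only [ENNReal.toReal_ofReal (show 0 ≤ 1 - t by linarith [ht.2]), smul_eq_mul]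
      ring
    rw [e₁, ← hD k]
    refine integral_congr_ae (hIoo.mono fun t ht => ?_)
    simp only [ENNReal.toReal_ofReal
      (mul_nonneg (show 0 ≤ 1 - t by linarith [ht.2]) (hnn t ht)), smul_eq_mul]
end

section
/- The fixed point measure μ admits a nondecreasing convex density 𝒟 : (0,1) → [0,∞) with respect to Lebesgue measure on (0,1), and this density satisfies lim_{t→1⁻} 𝒟(t)·√(2π(1−t)) = 1, i.e. 𝒟(t) ∼ 1/√(2π(1−t)) as t → 1. -/
open MeasureTheory Set Filter

theorem inv_fpSeq_succ (n : ℕ) : (fpSeq (n + 1))⁻¹ = (fpSeq n)⁻¹ + fpSeq (n + 1) := by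
  have h0 := fpSeq_pos n
  have h1 := fpSeq_pos (n + 1)
  have key : fpSeq n * fpSeq (n + 1) ^ 2 + fpSeq (n + 1) - fpSeq n = 0 := by
    have hs := Real.sq_sqrt (show 0 ≤ 1 + 4 * fpSeq n ^ 2 by positivity)
    rw [fpSeq]
    set q := Real.sqrt (1 + 4 * fpSeq n ^ 2)
    field_simp
    linarith
  field_simp
  linarith

theorem fpSeq_succ_lt (n : ℕ) : fpSeq (n + 1) < fpSeq n := by
  have h0 := fpSeq_pos n
  have h1 := fpSeq_pos (n + 1)
  have h := inv_fpSeq_succ n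
  exact (inv_lt_inv₀ h0 h1).1 (by linarith)

theorem fpSeq_antitone : Antitone fpSeq :=
  antitone_nat_of_succ_le fun n => (fpSeq_succ_lt n).le

theorem inv_sq_fpSeq_succ (n : ℕ) :
    (fpSeq (n + 1))⁻¹ ^ 2 - (fpSeq n)⁻¹ ^ 2 = 2 - fpSeq (n + 1) ^ 2 := by
  have h1 := fpSeq_pos (n + 1)
  have h : (fpSeq n)⁻¹ = (fpSeq (n + 1))⁻¹ - fpSeq (n + 1) := by
    rw [inv_fpSeq_succ n]; ring
  rw [h]
  field_simp
  ring

theorem le_inv_sq_fpSeq (n : ℕ) : (n : ℝ) ≤ (fpSeq n)⁻¹ ^ 2 := by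
  induction n with
  | zero => simp; positivity
  | succ n ih =>
    have h1 := fpSeq_pos (n + 1)
    have h2 : fpSeq (n + 1) ≤ 1 := by
      simpa [fpSeq] using fpSeq_antitone (Nat.zero_le (n + 1))
    have := inv_sq_fpSeq_succ n
    push_cast
    nlinarith

theorem tendsto_fpSeq_sq : Tendsto (fun n => fpSeq n ^ 2) atTop (nhds 0) := by
  refine squeeze_zero' (Eventually.of_forall fun n => by positivity) ?_
    tendsto_inv_atTop_nhds_zero_nat
  filter_upwards [eventually_gt_atTop 0] with n hn
  have h0 := fpSeq_pos n
  have h := le_inv_sq_fpSeq n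
  have hn' : (0:ℝ) < n := by exact_mod_cast hn
  rw [le_inv_comm₀ (by positivity) hn', ← inv_pow]
  exact h

theorem tendsto_sqrt_mul_fpSeq :
    Tendsto (fun n : ℕ => Real.sqrt n * fpSeq n) atTop (nhds (Real.sqrt 2)⁻¹) := by
  have h1 : Tendsto (fun n : ℕ => 2 - fpSeq (n + 1) ^ 2) atTop (nhds 2) := by
    simpa using (tendsto_const_nhds (x := (2:ℝ))).sub
      (tendsto_fpSeq_sq.comp (tendsto_add_atTop_nat 1))
  have h2 := h1.cesaro
  have h3 : ∀ n : ℕ, ∑ i ∈ Finset.range n, (2 - fpSeq (i + 1) ^ 2) = (fpSeq n)⁻¹ ^ 2 - 1 := by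
    intro n
    rw [← Finset.sum_congr rfl fun i _ => inv_sq_fpSeq_succ i,
      Finset.sum_range_sub fun i => (fpSeq i)⁻¹ ^ 2]
    simp [fpSeq]
  have h4 : Tendsto (fun n : ℕ => (n : ℝ)⁻¹ * (fpSeq n)⁻¹ ^ 2) atTop (nhds 2) := by
    have := h2.add (tendsto_inv_atTop_nhds_zero_nat (𝕜 := ℝ))
    rw [add_zero] at this
    refine this.congr fun n => ?_
    rw [h3]; ring
  have h5 := (h4.inv₀ two_ne_zero).sqrt
  rw [Real.sqrt_inv] at h5
  refine h5.congr fun n => ?_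
  have h0 := fpSeq_pos n
  rw [mul_inv, inv_inv, inv_pow, inv_inv, Real.sqrt_mul (by positivity), Real.sqrt_sq h0.le]

/-- The rational map `z ↦ z - 1 / z`. -/
noncomputable def subInv (z : ℝ) : ℝ := z - z⁻¹

theorem subInv_lt_subInv {v u : ℝ} (hv : 0 < v) (h : v < u) : subInv v < subInv u := by
  have := (inv_lt_inv₀ (hv.trans h) hv).2 h
  unfold subInv; linarith

theorem subInv_le_subInv {v u : ℝ} (hv : 0 < v) (h : v ≤ u) : subInv v ≤ subInv u := by
  rcases h.eq_or_lt with rfl | h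
  · exact le_rfl
  · exact (subInv_lt_subInv hv h).le

theorem le_of_subInv_le_subInv {v u : ℝ} (hu : 0 < u) (h : subInv v ≤ subInv u) : v ≤ u := by
  by_contra! h'
  exact absurd (subInv_lt_subInv hu h') (not_lt.2 h)

theorem subInv_inv_fpSeq_succ (n : ℕ) : subInv (fpSeq (n + 1))⁻¹ = (fpSeq n)⁻¹ := by
  unfold subInv
  rw [inv_inv, inv_fpSeq_succ]; ring

theorem iterate_subInv_bounds (k n : ℕ) {u : ℝ} (hu : (fpSeq (n + k))⁻¹ ≤ u) :
    (fpSeq k)⁻¹ ≤ subInv^[n] u ∧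
    subInv^[n] u - (fpSeq k)⁻¹ ≤ (u - (fpSeq (n + k))⁻¹) * (fpSeq (n + k))⁻¹ * fpSeq k := by
  induction n generalizing u with
  | zero =>
    have := fpSeq_pos k
    simp only [zero_add, Function.iterate_zero, id] at *
    refine ⟨hu, le_of_eq ?_⟩
    field_simp
  | succ n ih =>
    rw [Function.iterate_succ_apply]
    have e : n + 1 + k = n + k + 1 := by ring
    rw [e] at hu ⊢
    have hp := fpSeq_pos (n + k)
    have hp1 := fpSeq_pos (n + k + 1)
    have hk := fpSeq_pos k
    have hle : (fpSeq (n + k))⁻¹ ≤ subInv u := by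
      rw [← subInv_inv_fpSeq_succ]
      exact subInv_le_subInv (by positivity) hu
    obtain ⟨h1, h2⟩ := ih hle
    refine ⟨h1, h2.trans (mul_le_mul_of_nonneg_right ?_ hk.le)⟩
    rw [← subInv_inv_fpSeq_succ (n + k)]
    set v := (fpSeq (n + k + 1))⁻¹ with hv
    have hv0 : 0 < v := by positivity
    have hu0 : 0 < u := hv0.trans_le hu
    have hiv : v⁻¹ * v = 1 := inv_mul_cancel₀ hv0.ne'
    have hiu : u⁻¹ * u = 1 := inv_mul_cancel₀ hu0.ne'
    have hle' : u⁻¹ ≤ v⁻¹ := inv_anti₀ hv0 hu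
    have hdiff : subInv u - subInv v ≤ (u - v) * (1 + v⁻¹ ^ 2) := by
      have : v⁻¹ - u⁻¹ = (u - v) * (u⁻¹ * v⁻¹) := by field_simp
      have h3 : u⁻¹ * v⁻¹ ≤ v⁻¹ ^ 2 := by
        rw [sq]; exact mul_le_mul_of_nonneg_right hle' (by positivity)
      have := mul_le_mul_of_nonneg_left h3 (sub_nonneg.2 hu)
      unfold subInv; linarith
    have hvn : 0 ≤ subInv v := by
      rw [hv, subInv_inv_fpSeq_succ]; positivity
    have hstep : (1 + v⁻¹ ^ 2) * subInv v ≤ v := by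
      have : (1 + v⁻¹ ^ 2) * subInv v = v - v⁻¹ ^ 3 := by
        unfold subInv; field_simp; ring
      have : 0 < v⁻¹ ^ 3 := by positivity
      linarith
    calc (subInv u - subInv v) * subInv v ≤ (u - v) * (1 + v⁻¹ ^ 2) * subInv v :=
          mul_le_mul_of_nonneg_right hdiff hvn
      _ = (u - v) * ((1 + v⁻¹ ^ 2) * subInv v) := by ring
      _ ≤ (u - v) * v := mul_le_mul_of_nonneg_left hstep (sub_nonneg.2 hu)

theorem inv_fpSeq_add_bounds (n k : ℕ) :
    (fpSeq n)⁻¹ + k * fpSeq (n + k) ≤ (fpSeq (n + k))⁻¹ ∧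
    (fpSeq (n + k))⁻¹ ≤ (fpSeq n)⁻¹ + k * fpSeq n := by
  induction k with
  | zero => simp
  | succ k ih =>
    have h := inv_fpSeq_succ (n + k)
    have h1 : fpSeq (n + k + 1) ≤ fpSeq (n + k) := (fpSeq_succ_lt _).le
    have h2 : fpSeq (n + k + 1) ≤ fpSeq n := fpSeq_antitone (by omega)
    have h3 := mul_le_mul_of_nonneg_left h1 (Nat.cast_nonneg (α := ℝ) k)
    rw [← add_assoc, h]
    push_cast
    constructor <;> linarith [ih.1, ih.2]

theorem tendsto_iterate_subInv (k : ℕ) :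
    Tendsto (fun n => subInv^[n] ((fpSeq n)⁻¹ + k * fpSeq n)) atTop (nhds (fpSeq k)⁻¹) := by
  have hlim : Tendsto (fun n => (fpSeq k)⁻¹ + k ^ 2 * fpSeq k * fpSeq n ^ 2) atTop
      (nhds (fpSeq k)⁻¹) := by
    simpa using (tendsto_const_nhds (x := (fpSeq k)⁻¹)).add
      (tendsto_fpSeq_sq.const_mul ((k:ℝ) ^ 2 * fpSeq k))
  refine tendsto_of_tendsto_of_tendsto_of_le_of_le tendsto_const_nhds hlim ?_ ?_
  · intro n
    exact (iterate_subInv_bounds k n (inv_fpSeq_add_bounds n k).2).1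
  · intro n
    have h := (iterate_subInv_bounds k n (inv_fpSeq_add_bounds n k).2).2
    have h1 := (inv_fpSeq_add_bounds n k).1
    have h2 := (inv_fpSeq_add_bounds n k).2
    have hn := fpSeq_pos n
    have hk := fpSeq_pos k
    have hnk := fpSeq_pos (n + k)
    have e : ((fpSeq n)⁻¹ + k * fpSeq n - (fpSeq (n + k))⁻¹) * (fpSeq (n + k))⁻¹
        ≤ k ^ 2 * fpSeq n ^ 2 := by
      have e1 : (fpSeq n)⁻¹ + k * fpSeq n - (fpSeq (n + k))⁻¹ ≤ k * (fpSeq n - fpSeq (n + k)) := by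
        linarith
      have e2 : fpSeq n - fpSeq (n + k) =
          ((fpSeq (n + k))⁻¹ - (fpSeq n)⁻¹) * (fpSeq n * fpSeq (n + k)) := by field_simp
      have e3 : fpSeq n - fpSeq (n + k) ≤ k * fpSeq n * (fpSeq n * fpSeq (n + k)) := by
        rw [e2]; exact mul_le_mul_of_nonneg_right (by linarith) (by positivity)
      calc _ ≤ k * (k * fpSeq n * (fpSeq n * fpSeq (n + k))) * (fpSeq (n + k))⁻¹ := by
            refine mul_le_mul_of_nonneg_right (e1.trans ?_) (by positivity)
            exact mul_le_mul_of_nonneg_left e3 (Nat.cast_nonneg k)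
        _ = _ := by field_simp
    have := mul_le_mul_of_nonneg_right e hk.le
    linarith

theorem one_div_subInv_sub_eq (c w : ℝ) (hw : 0 < w) {r : ℝ} (hr : 0 < r) (hc : subInv r = c)
    (hwr : r < w) :
    1 / (subInv w - c) = r ^ 2 / (r ^ 2 + 1) / (w - r) + 1 / (r ^ 2 + 1) / (w - -r⁻¹) := by
  have h1 : w - r ≠ 0 := (sub_pos.2 hwr).ne'
  have h2 : r * w + 1 ≠ 0 := by positivity
  have h3 : subInv w - c = (w - r) * (r * w + 1) / (r * w) := by
    rw [← hc]; unfold subInv; field_simp; ring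
  have h4 : w - -r⁻¹ = (r * w + 1) / r := by field_simp; ring
  rw [h3, h4]
  field_simp
  ring

theorem exists_pos_subInv_eq (c : ℝ) : ∃ r, 0 < r ∧ subInv r = c := by
  have h : |c| < Real.sqrt (c ^ 2 + 4) := by
    rw [← Real.sqrt_sq_eq_abs]; exact Real.sqrt_lt_sqrt (by positivity) (by linarith)
  have hs := Real.sq_sqrt (show 0 ≤ c ^ 2 + 4 by positivity)
  have hpos : 0 < c + Real.sqrt (c ^ 2 + 4) := by linarith [neg_abs_le c]
  refine ⟨(c + Real.sqrt (c ^ 2 + 4)) / 2, by linarith, ?_⟩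
  unfold subInv
  field_simp
  nlinarith

theorem inv_iterate_subInv_eq_sum (n : ℕ) :
    ∃ (ι : Type) (_ : Fintype ι) (ρ c : ι → ℝ), (∀ j, 0 ≤ ρ j) ∧
      (∀ j, c j = (fpSeq n)⁻¹ ∨ c j ≤ (fpSeq n)⁻¹ - fpSeq n) ∧
      ∀ w, (fpSeq n)⁻¹ < w → 1 / subInv^[n + 1] w = ∑ j, ρ j / (w - c j) := by
  induction n with
  | zero =>
    refine ⟨Bool, inferInstance, fun _ => 1 / 2, fun b => if b then 1 else -1,
      fun _ => by norm_num, fun b => by cases b <;> simp [fpSeq], fun w hw => ?_⟩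
    have hw' : 1 < w := by simpa [fpSeq] using hw
    have h := one_div_subInv_sub_eq 0 w (by linarith) one_pos (by simp [subInv]) hw'
    simp only [sub_zero] at h
    rw [zero_add, Function.iterate_one, h]
    norm_num
  | succ n ih =>
    obtain ⟨ι, _, ρ, c, hρ, hc, hsum⟩ := ih
    choose r hr hrc using exists_pos_subInv_eq
    have hn := fpSeq_pos n
    have hn1 := fpSeq_pos (n + 1)
    have hdiff : (fpSeq (n + 1))⁻¹ - fpSeq (n + 1) = (fpSeq n)⁻¹ := by
      rw [inv_fpSeq_succ]; ring
    have hcase : ∀ j, r (c j) = (fpSeq (n + 1))⁻¹ ∨ r (c j) ≤ (fpSeq n)⁻¹ := by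
      intro j
      rcases hc j with h | h
      · left
        have e : subInv (r (c j)) = subInv (fpSeq (n + 1))⁻¹ := by
          rw [hrc, h, subInv_inv_fpSeq_succ]
        exact le_antisymm (le_of_subInv_le_subInv (by positivity) e.le)
          (le_of_subInv_le_subInv (hr _) e.ge)
      · right
        refine le_of_subInv_le_subInv (by positivity) ?_
        rw [hrc]; simpa [subInv] using h
    refine ⟨ι ⊕ ι, inferInstance,
      Sum.elim (fun j => ρ j * (r (c j) ^ 2 / (r (c j) ^ 2 + 1)))
        (fun j => ρ j * (1 / (r (c j) ^ 2 + 1))),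
      Sum.elim (fun j => r (c j)) (fun j => -(r (c j))⁻¹), ?_, ?_, ?_⟩
    · rintro (j | j) <;> simp only [Sum.elim_inl, Sum.elim_inr] <;>
        exact mul_nonneg (hρ j) (by positivity)
    · rw [hdiff]
      rintro (j | j)
      · exact hcase j
      · right
        have := hr (c j)
        have h1 : 0 < (r (c j))⁻¹ := by positivity
        have h2 : 0 < (fpSeq n)⁻¹ := by positivity
        simp only [Sum.elim_inr]
        linarith
    · intro w hw
      have hw0 : 0 < w := lt_trans (by positivity) hw
      rw [Function.iterate_succ_apply, hsum (subInv w)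
        (by rw [← subInv_inv_fpSeq_succ]; exact subInv_lt_subInv (by positivity) hw),
        Fintype.sum_sum_type, ← Finset.sum_add_distrib]
      refine Finset.sum_congr rfl fun j _ => ?_
      have hlt : r (c j) < w := by
        rcases hcase j with h | h <;> linarith
      have := one_div_subInv_sub_eq (c j) w hw0 (hr _) (hrc _) hlt
      simp only [Sum.elim_inl, Sum.elim_inr]
      rw [div_eq_mul_one_div, this]
      ring

theorem setIntegral_Ioo_rpow {e : ℝ} (he : 0 ≤ e) :
    ∫ t in Ioo (0:ℝ) 1, t ^ e = 1 / (e + 1) := by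
  rw [← integral_Ioc_eq_integral_Ioo, ← intervalIntegral.integral_of_le zero_le_one,
    integral_rpow (Or.inl (by linarith)), Real.one_rpow, Real.zero_rpow (by linarith), sub_zero]

theorem integrableOn_Ioo_rpow_of_nonneg {e : ℝ} (he : 0 ≤ e) :
    IntegrableOn (fun t : ℝ => t ^ e) (Ioo 0 1) :=
  (intervalIntegral.integrableOn_Ioo_rpow_iff one_pos).2 (by linarith)

theorem exists_density_approx (n : ℕ) :
    ∃ D : ℝ → ℝ, (∀ t ∈ Ioo (0:ℝ) 1, 0 ≤ D t) ∧ MonotoneOn D (Ioo (0:ℝ) 1) ∧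
      ConvexOn ℝ (Ioo (0:ℝ) 1) D ∧ Continuous D ∧
      ∀ k : ℕ, ∫ t in Ioo (0:ℝ) 1, t ^ k * D t
        = 1 / subInv^[n + 1] ((fpSeq (n + 1))⁻¹ + k * fpSeq (n + 1)) := by
  obtain ⟨ι, _, ρ, c, hρ, hc, hsum⟩ := inv_iterate_subInv_eq_sum n
  set m := fpSeq (n + 1) with hm
  have hm0 : 0 < m := fpSeq_pos _
  set e : ι → ℝ := fun j => (m⁻¹ - c j) / m - 1 with he
  have hdiff : (fpSeq n)⁻¹ = m⁻¹ - m := by rw [hm, inv_fpSeq_succ]; ring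
  have hmn : m < fpSeq n := fpSeq_succ_lt n
  have hecase : ∀ j, e j = 0 ∨ 1 ≤ e j := by
    intro j
    rcases hc j with h | h
    · left
      simp only [he, h, hdiff]
      field_simp; ring
    · right
      have : 2 ≤ (m⁻¹ - c j) / m := by rw [le_div_iff₀ hm0]; linarith
      simp only [he]; linarith
  have he0 : ∀ j, 0 ≤ e j := fun j => by rcases hecase j with h | h <;> linarith
  have hρm : ∀ j, 0 ≤ ρ j / m := fun j => div_nonneg (hρ j) hm0.le
  refine ⟨fun t => ∑ j, ρ j / m * t ^ e j, ?_, ?_, ?_, ?_, ?_⟩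
  · intro t ht
    exact Finset.sum_nonneg fun j _ => mul_nonneg (hρm j) (Real.rpow_nonneg ht.1.le _)
  · intro t ht u hu htu
    exact Finset.sum_le_sum fun j _ =>
      mul_le_mul_of_nonneg_left (Real.rpow_le_rpow ht.1.le htu (he0 j)) (hρm j)
  · have hj : ∀ j, ConvexOn ℝ (Ioo (0:ℝ) 1) fun t => ρ j / m * t ^ e j := by
      intro j
      refine ConvexOn.smul (hρm j) ?_
      rcases hecase j with h | h
      · simpa [h] using convexOn_const (1:ℝ) (convex_Ioo (0:ℝ) 1)
      · exact (convexOn_rpow h).subset (fun t ht => ht.1.le) (convex_Ioo 0 1)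
    refine ⟨convex_Ioo 0 1, fun x hx y hy a b ha hb hab => ?_⟩
    simp only [Finset.smul_sum, ← Finset.sum_add_distrib]
    exact Finset.sum_le_sum fun j _ => (hj j).2 hx hy ha hb hab
  · exact continuous_finsetSum _ fun j _ =>
      (Real.continuous_rpow_const (he0 j)).const_mul _
  · intro k
    have hk0 : (0:ℝ) ≤ k * m := by positivity
    rw [hsum _ (by linarith)]
    have hinteg : ∀ t ∈ Ioo (0:ℝ) 1, t ^ k * ∑ j, ρ j / m * t ^ e j
        = ∑ j, ρ j / m * t ^ (k + e j) := by
      intro t ht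
      rw [Finset.mul_sum]
      refine Finset.sum_congr rfl fun j _ => ?_
      rw [Real.rpow_add ht.1, Real.rpow_natCast]; ring
    have hke : ∀ j, 0 ≤ k + e j := fun j => add_nonneg (Nat.cast_nonneg k) (he0 j)
    rw [setIntegral_congr_fun measurableSet_Ioo hinteg, integral_finsetSum _ fun j _ =>
      (integrableOn_Ioo_rpow_of_nonneg (hke j)).const_mul _]
    refine Finset.sum_congr rfl fun j _ => ?_
    rw [integral_const_mul, setIntegral_Ioo_rpow (hke j)]
    have h1 := hke j
    have h2 : k + e j + 1 = (m⁻¹ + k * m - c j) / m := by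
      simp only [he]; field_simp; ring
    rw [h2]
    have h3 : 0 < (m⁻¹ + k * m - c j) / m := by rw [← h2]; linarith
    have h4 : m⁻¹ + k * m - c j ≠ 0 := fun h => by simp [h] at h3
    field_simp

/-- Dominated by the mass to its right, a monotone probability density is at most `1 / (1 - t)`. -/
theorem le_inv_one_sub_of_monotoneOn {D : ℝ → ℝ} (h0 : ∀ t ∈ Ioo (0:ℝ) 1, 0 ≤ D t)
    (hmono : MonotoneOn D (Ioo (0:ℝ) 1)) (hinteg : IntegrableOn D (Ioo 0 1))
    (h1 : ∫ t in Ioo (0:ℝ) 1, D t ≤ 1) {t : ℝ} (ht : t ∈ Ioo (0:ℝ) 1) : D t ≤ (1 - t)⁻¹ := by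
  have ht1 : 0 < 1 - t := sub_pos.2 ht.2
  have hsub : Ioo t 1 ⊆ Ioo 0 1 := Ioo_subset_Ioo_left ht.1.le
  have hle : ∫ _ in Ioo t 1, D t ≤ ∫ u in Ioo t 1, D u :=
    setIntegral_mono_on (by simp) (hinteg.mono_set hsub) measurableSet_Ioo
      fun u hu => hmono ht (hsub hu) hu.1.le
  have hle2 : ∫ u in Ioo t 1, D u ≤ ∫ u in Ioo 0 1, D u :=
    setIntegral_mono_set hinteg ((ae_restrict_iff' measurableSet_Ioo).2 (.of_forall h0))
      hsub.eventuallyLE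
  rw [setIntegral_const] at hle
  simp only [smul_eq_mul, Real.volume_real_Ioo_of_le ht.2.le] at hle
  rw [← one_div, le_div_iff₀ ht1]
  linarith

/-- An upper slope bound for nonnegative convex functions bounded by `1 / (1 - t)`. -/
theorem sub_le_of_convexOn {D : ℝ → ℝ} (h0 : ∀ t ∈ Ioo (0:ℝ) 1, 0 ≤ D t)
    (hconv : ConvexOn ℝ (Ioo (0:ℝ) 1) D) (hb : ∀ t ∈ Ioo (0:ℝ) 1, D t ≤ (1 - t)⁻¹)
    {x y z : ℝ} (hx : 0 < x) (hxy : x ≤ y) (hyz : y < z) (hz : z < 1) :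
    D y - D x ≤ (1 - z)⁻¹ / (z - y) * (y - x) := by
  rcases hxy.eq_or_lt with rfl | hxy
  · simp
  have hx' : x ∈ Ioo (0:ℝ) 1 := ⟨hx, by linarith⟩
  have hz' : z ∈ Ioo (0:ℝ) 1 := ⟨by linarith, hz⟩
  have h := hconv.slope_mono_adjacent hx' hz' hxy hyz
  have h2 : (D z - D y) / (z - y) ≤ (1 - z)⁻¹ / (z - y) :=
    div_le_div_of_nonneg_right (by linarith [hb z hz', h0 y ⟨by linarith, by linarith⟩])
      (by linarith)
  exact (div_le_iff₀ (by linarith)).1 (h.trans h2)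

/-- A selection principle for monotone convex functions bounded by `1 / (1 - t)`. -/
theorem exists_subseq_tendsto_of_convexOn {D : ℕ → ℝ → ℝ}
    (h0 : ∀ n, ∀ t ∈ Ioo (0:ℝ) 1, 0 ≤ D n t) (hmono : ∀ n, MonotoneOn (D n) (Ioo (0:ℝ) 1))
    (hconv : ∀ n, ConvexOn ℝ (Ioo (0:ℝ) 1) (D n))
    (hb : ∀ n, ∀ t ∈ Ioo (0:ℝ) 1, D n t ≤ (1 - t)⁻¹) :
    ∃ (φ : ℕ → ℕ) (E : ℝ → ℝ), StrictMono φ ∧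
      ∀ t ∈ Ioo (0:ℝ) 1, Tendsto (fun n => D (φ n) t) atTop (nhds (E t)) := by
  have hcomp : IsCompact (univ.pi fun q : {q : ℚ // (q:ℝ) ∈ Ioo (0:ℝ) 1} =>
      Icc (0:ℝ) (1 - (q.1:ℝ))⁻¹) := isCompact_univ_pi fun _ => isCompact_Icc
  obtain ⟨a, -, φ, hφ, ha⟩ := hcomp.tendsto_subseq
    (x := fun n q => D n (q.1:ℝ)) (fun n q _ => ⟨h0 n _ q.2, hb n _ q.2⟩)
  rw [tendsto_pi_nhds] at ha
  have hcauchy : ∀ t ∈ Ioo (0:ℝ) 1, ∃ l, Tendsto (fun n => D (φ n) t) atTop (nhds l) := by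
    intro t ht
    refine cauchySeq_tendsto_of_complete (Metric.cauchySeq_iff'.2 fun ε hε => ?_)
    obtain ⟨z, htz, hz⟩ := exists_between ht.2
    set L := (1 - z)⁻¹ / (z - t) with hL
    have hL0 : 0 < L := div_pos (inv_pos.2 (by linarith)) (by linarith)
    obtain ⟨q, hq1, hq2⟩ := exists_rat_btwn (show max (t / 2) (t - ε / (4 * L)) < t from
      max_lt (by linarith [ht.1]) (by linarith [show 0 < ε / (4 * L) by positivity]))
    have hq0 : (0:ℝ) < q := lt_of_le_of_lt (by linarith [ht.1]) ((le_max_left _ _).trans_lt hq1)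
    have hqt : t - ε / (4 * L) < q := (le_max_right _ _).trans_lt hq1
    have hqm : (q:ℝ) ∈ Ioo (0:ℝ) 1 := ⟨hq0, hq2.trans ht.2⟩
    have hclose : ∀ n, |D n t - D n q| < ε / 4 := by
      intro n
      have h1 := hmono n hqm ht hq2.le
      have h2 := sub_le_of_convexOn (h0 n) (hconv n) (hb n) hq0 hq2.le htz hz
      rw [abs_of_nonneg (by linarith)]
      refine h2.trans_lt ?_
      rw [← hL]
      calc L * (t - q) < L * (ε / (4 * L)) := mul_lt_mul_of_pos_left (by linarith) hL0
        _ = ε / 4 := by field_simp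
    have hqc : CauchySeq fun n => D (φ n) q := (ha ⟨q, hqm⟩).cauchySeq
    obtain ⟨N, hN⟩ := Metric.cauchySeq_iff'.1 hqc (ε / 4) (by positivity)
    refine ⟨N, fun n hn => ?_⟩
    have h1 := abs_lt.1 (hclose (φ n))
    have h2 := abs_lt.1 (hclose (φ N))
    have h3 := hN n hn
    rw [Real.dist_eq] at h3 ⊢
    have h3 := abs_lt.1 h3
    rw [abs_lt]
    constructor <;> linarith [h1.1, h1.2, h2.1, h2.2, h3.1, h3.2]
  choose! E hE using hcauchy
  exact ⟨φ, E, hφ, hE⟩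

theorem integrable_mul_comp {α : Type*} [MeasurableSpace α] {μ : Measure α} {w X : α → ℝ}
    (hw : Integrable w μ) (hX : Measurable X) (hX01 : ∀ᵐ a ∂μ, X a ∈ Icc (0:ℝ) 1)
    {g : ℝ → ℝ} (hg : Continuous g) : Integrable (fun a => w a * g (X a)) μ := by
  obtain ⟨C, hC⟩ := isCompact_Icc.exists_bound_of_continuousOn (hg.continuousOn (s := Icc (0:ℝ) 1))
  refine hw.mul_bdd (c := C) (hg.measurable.comp hX).aestronglyMeasurable ?_
  filter_upwards [hX01] with a ha using hC _ ha

theorem integral_mul_polynomial_comp {α : Type*} [MeasurableSpace α] {μ : Measure α}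
    {w X : α → ℝ} (hw : Integrable w μ) (hX : Measurable X)
    (hX01 : ∀ᵐ a ∂μ, X a ∈ Icc (0:ℝ) 1) (p : Polynomial ℝ) :
    ∫ a, w a * p.eval (X a) ∂μ
      = ∑ k ∈ Finset.range (p.natDegree + 1), p.coeff k * ∫ a, w a * X a ^ k ∂μ := by
  simp only [← integral_const_mul]
  rw [← integral_finsetSum]
  · refine integral_congr_ae (.of_forall fun a => ?_)
    simp only [Polynomial.eval_eq_sum_range, Finset.mul_sum]
    exact Finset.sum_congr rfl fun k _ => by ring
  · exact fun k _ => (integrable_mul_comp hw hX hX01 (continuous_pow k)).const_mul _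

theorem abs_integral_mul_comp_sub_le {α : Type*} [MeasurableSpace α] {μ : Measure α}
    {w X : α → ℝ} (hw : Integrable w μ) (hw0 : ∀ᵐ a ∂μ, 0 ≤ w a) (hX : Measurable X)
    (hX01 : ∀ᵐ a ∂μ, X a ∈ Icc (0:ℝ) 1) {g h : ℝ → ℝ} (hg : Continuous g) (hh : Continuous h)
    {ε : ℝ} (hgh : ∀ x ∈ Icc (0:ℝ) 1, |h x - g x| ≤ ε) :
    |∫ a, w a * h (X a) ∂μ - ∫ a, w a * g (X a) ∂μ| ≤ ε * ∫ a, w a ∂μ := by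
  rw [← integral_sub (integrable_mul_comp hw hX hX01 hh) (integrable_mul_comp hw hX hX01 hg),
    ← integral_const_mul, ← Real.norm_eq_abs]
  refine norm_integral_le_of_norm_le (hw.const_mul ε) ?_
  filter_upwards [hw0, hX01] with a h1 h2
  rw [← mul_sub, norm_mul, Real.norm_of_nonneg h1, mul_comm]
  exact mul_le_mul_of_nonneg_right (hgh _ h2) h1

/-- The method of moments for weighted integrals of `[0, 1]`-valued functions. -/
theorem tendsto_integral_mul_comp_of_moments {α β : Type*} [MeasurableSpace α]
    [MeasurableSpace β] {μ : Measure α} {ν : Measure β} {w X : ℕ → α → ℝ} {v Y : β → ℝ}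
    (hw : ∀ n, Integrable (w n) μ) (hw0 : ∀ n, ∀ᵐ a ∂μ, 0 ≤ w n a) (hX : ∀ n, Measurable (X n))
    (hX01 : ∀ n, ∀ᵐ a ∂μ, X n a ∈ Icc (0:ℝ) 1)
    (hv : Integrable v ν) (hv0 : ∀ᵐ b ∂ν, 0 ≤ v b) (hY : Measurable Y)
    (hY01 : ∀ᵐ b ∂ν, Y b ∈ Icc (0:ℝ) 1)
    (hmom : ∀ k : ℕ, Tendsto (fun n => ∫ a, w n a * X n a ^ k ∂μ) atTop
      (nhds (∫ b, v b * Y b ^ k ∂ν)))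
    {g : ℝ → ℝ} (hg : Continuous g) :
    Tendsto (fun n => ∫ a, w n a * g (X n a) ∂μ) atTop (nhds (∫ b, v b * g (Y b) ∂ν)) := by
  rw [Metric.tendsto_atTop']
  intro ε hε
  set M := ∫ b, v b ∂ν with hM
  have hM0 : 0 ≤ M := integral_nonneg_of_ae hv0
  set δ := ε / (4 * (M + 1)) with hδ
  have hδ0 : 0 < δ := by positivity
  have hδM : δ * (M + 1) = ε / 4 := by rw [hδ]; field_simp
  obtain ⟨p, hp⟩ := exists_polynomial_near_of_continuousOn 0 1 g hg.continuousOn δ hδ0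
  have hpl : Tendsto (fun n => ∫ a, w n a * p.eval (X n a) ∂μ) atTop
      (nhds (∫ b, v b * p.eval (Y b) ∂ν)) := by
    simp only [integral_mul_polynomial_comp (hw _) (hX _) (hX01 _),
      integral_mul_polynomial_comp hv hY hY01]
    exact tendsto_finsetSum _ fun k _ => (hmom k).const_mul _
  have hmass : ∀ᶠ n in atTop, ∫ a, w n a ∂μ < M + 1 := by
    have := hmom 0
    simp only [pow_zero, mul_one] at this
    exact this.eventually_lt_const (by linarith)
  have hpe := Metric.tendsto_nhds.1 hpl (ε / 4) (by positivity)
  obtain ⟨N, hN⟩ := eventually_atTop.1 (hmass.and hpe)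
  refine ⟨N, fun n hn => ?_⟩
  obtain ⟨h1, h2⟩ := hN n hn.le
  have h3 := abs_integral_mul_comp_sub_le (hw n) (hw0 n) (hX n) (hX01 n) hg p.continuous
    fun x hx => (hp x hx).le
  have h4 := abs_integral_mul_comp_sub_le hv hv0 hY hY01 hg p.continuous
    fun x hx => (hp x hx).le
  have h5 : δ * ∫ a, w n a ∂μ ≤ ε / 4 := hδM ▸ mul_le_mul_of_nonneg_left h1.le hδ0.le
  have h6 : δ * M ≤ ε / 4 := hδM ▸ mul_le_mul_of_nonneg_left (by linarith) hδ0.le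
  rw [Real.dist_eq] at h2 ⊢
  have h2 := abs_lt.1 h2
  have h3 := abs_le.1 (h3.trans h5)
  have h4 := abs_le.1 (h4.trans h6)
  rw [abs_lt]
  constructor <;> linarith [h2.1, h2.2, h3.1, h3.2, h4.1, h4.2]

theorem withDensity_eq_of_moments {μ ν : Measure ℝ} {w v : ℝ → ℝ} (hwm : Measurable w)
    (hvm : Measurable v) (hw : Integrable w μ) (hw0 : ∀ᵐ t ∂μ, 0 ≤ w t)
    (hμ : ∀ᵐ t ∂μ, t ∈ Icc (0:ℝ) 1) (hv : Integrable v ν) (hv0 : ∀ᵐ t ∂ν, 0 ≤ v t)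
    (hν : ∀ᵐ t ∂ν, t ∈ Icc (0:ℝ) 1)
    (hmom : ∀ k : ℕ, ∫ t, w t * t ^ k ∂μ = ∫ t, v t * t ^ k ∂ν) :
    μ.withDensity (fun t => ENNReal.ofReal (w t)) =
      ν.withDensity (fun t => ENNReal.ofReal (v t)) := by
  have hfin : ∀ {μ : Measure ℝ} {w : ℝ → ℝ}, Integrable w μ →
      IsFiniteMeasure (μ.withDensity fun t => ENNReal.ofReal (w t)) := fun h =>
    isFiniteMeasure_withDensity_ofReal h.2
  have := hfin hw
  have := hfin hv
  refine ext_of_forall_integral_eq_of_IsFiniteMeasure fun f => ?_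
  rw [integral_withDensity_eq_integral_toReal_smul hwm.ennreal_ofReal (by simp),
    integral_withDensity_eq_integral_toReal_smul hvm.ennreal_ofReal (by simp)]
  have h := tendsto_nhds_unique tendsto_const_nhds
    (tendsto_integral_mul_comp_of_moments (fun _ => hw) (fun _ => hw0) (fun _ => measurable_id)
      (fun _ => hμ) hv hv0 measurable_id hν (fun k => by simp [hmom k]) f.continuous)
  simp only [id] at h
  rw [integral_congr_ae (g := fun t => w t * f t), h, integral_congr_ae]
  · filter_upwards [hv0] with t ht
    rw [ENNReal.toReal_ofReal ht, smul_eq_mul]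
  · filter_upwards [hw0] with t ht
    rw [ENNReal.toReal_ofReal ht, smul_eq_mul]

theorem exists_convex_limit_density : ∃ D : ℝ → ℝ, Measurable D ∧
    (∀ t ∈ Ioo (0:ℝ) 1, 0 ≤ D t) ∧ MonotoneOn D (Ioo (0:ℝ) 1) ∧ ConvexOn ℝ (Ioo (0:ℝ) 1) D ∧
    (∀ t ∈ Ioo (0:ℝ) 1, D t ≤ (1 - t)⁻¹) ∧
    ∀ k : ℕ, ∫ t in Ioo (0:ℝ) 1, (1 - t) * D t * t ^ k = fpSeq k - fpSeq (k + 1) := by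
  choose D h0 hmono hconv hcont hmom using exists_density_approx
  have hpow : ∀ n k, IntegrableOn (fun t => t ^ k * D n t) (Ioo 0 1) := fun n k =>
    (((continuous_pow k).mul (hcont n)).integrableOn_Icc (a := 0) (b := 1)).mono_set
      Ioo_subset_Icc_self
  have hmass : ∀ n, ∫ t in Ioo (0:ℝ) 1, D n t ≤ 1 := by
    intro n
    have h := hmom n 0
    have h2 := iterate_subInv_bounds 0 (n + 1) (le_refl (fpSeq (n + 1 + 0))⁻¹)
    simp only [pow_zero, one_mul, Nat.cast_zero, zero_mul, add_zero] at h
    rw [h, div_le_one₀ (lt_of_lt_of_le (inv_pos.2 (fpSeq_pos 0)) h2.1)]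
    simpa [fpSeq] using h2.1
  have hb : ∀ n, ∀ t ∈ Ioo (0:ℝ) 1, D n t ≤ (1 - t)⁻¹ := fun n t ht =>
    le_inv_one_sub_of_monotoneOn (h0 n) (hmono n) (by simpa using hpow n 0) (hmass n) ht
  obtain ⟨φ, E, hφ, hE⟩ := exists_subseq_tendsto_of_convexOn h0 hmono hconv hb
  set F : ℝ → ℝ := (Ioo 0 1).indicator E with hF
  have hFE : ∀ t ∈ Ioo (0:ℝ) 1, F t = E t := fun t ht => indicator_of_mem ht E
  have hFlim : ∀ t ∈ Ioo (0:ℝ) 1, Tendsto (fun n => D (φ n) t) atTop (nhds (F t)) :=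
    fun t ht => hFE t ht ▸ hE t ht
  have hFb : ∀ t ∈ Ioo (0:ℝ) 1, F t ≤ (1 - t)⁻¹ := fun t ht =>
    le_of_tendsto' (hFlim t ht) fun n => hb _ t ht
  refine ⟨F, ?_, ?_, ?_, ?_, hFb, ?_⟩
  · refine measurable_of_tendsto_metrizable
      (f := fun n => (Ioo (0:ℝ) 1).indicator (D (φ n)))
      (fun n => (hcont _).measurable.indicator measurableSet_Ioo) ?_
    rw [tendsto_pi_nhds]
    intro t
    by_cases ht : t ∈ Ioo (0:ℝ) 1
    · simpa only [indicator_of_mem ht] using hFlim t ht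
    · simp only [hF, indicator_of_notMem ht, tendsto_const_nhds]
  · exact fun t ht => ge_of_tendsto' (hFlim t ht) fun n => h0 _ t ht
  · exact fun t ht u hu htu =>
      le_of_tendsto_of_tendsto' (hFlim t ht) (hFlim u hu) fun n => hmono _ ht hu htu
  · refine ⟨convex_Ioo 0 1, fun x hx y hy a b ha hb hab => ?_⟩
    exact le_of_tendsto_of_tendsto' (hFlim _ (convex_Ioo 0 1 hx hy ha hb hab))
      (((hFlim x hx).const_smul a).add ((hFlim y hy).const_smul b))
      fun n => (hconv _).2 hx hy ha hb hab
  · intro k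
    have hm : ∀ k, Tendsto (fun n => ∫ t in Ioo (0:ℝ) 1, t ^ k * D (φ n) t) atTop
        (nhds (fpSeq k)) := by
      intro k
      have hk := fpSeq_pos k
      have h := (((tendsto_iterate_subInv k).comp (tendsto_add_atTop_nat 1)).comp
        hφ.tendsto_atTop).inv₀ (inv_pos.2 hk).ne'
      rw [inv_inv] at h
      refine h.congr fun n => ?_
      rw [hmom, one_div]
      rfl
    have h1 := (hm k).sub (hm (k + 1))
    have h2 : Tendsto (fun n => ∫ t in Ioo (0:ℝ) 1, (1 - t) * D (φ n) t * t ^ k) atTop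
        (nhds (∫ t in Ioo (0:ℝ) 1, (1 - t) * F t * t ^ k)) := by
      refine tendsto_integral_of_dominated_convergence (fun _ => 1) (fun n => ?_) (by simp)
        (fun n => ?_) ?_
      · have := hcont (φ n)
        exact Continuous.aestronglyMeasurable (by fun_prop)
      · refine (ae_restrict_iff' measurableSet_Ioo).2 (.of_forall fun t ht => ?_)
        have ht1 : 0 < 1 - t := sub_pos.2 ht.2
        have e1 := h0 (φ n) t ht
        have e2 : (1 - t) * D (φ n) t ≤ 1 := by
          have := mul_le_mul_of_nonneg_left (hb (φ n) t ht) ht1.le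
          rwa [mul_inv_cancel₀ ht1.ne'] at this
        have e3 := pow_le_one₀ (n := k) ht.1.le ht.2.le
        have e4 := pow_nonneg ht.1.le k
        rw [Real.norm_of_nonneg (by positivity)]
        exact mul_le_one₀ e2 e4 e3
      · refine (ae_restrict_iff' measurableSet_Ioo).2 (.of_forall fun t ht => ?_)
        exact ((hFlim t ht).const_mul _).mul_const _
    refine tendsto_nhds_unique h2 (h1.congr fun n => ?_)
    rw [← integral_sub (hpow _ _) (hpow _ _)]
    exact integral_congr_ae (.of_forall fun t => by simp only; ring)

theorem measure_singleton_one_eq_zero_s17 (μ : Measure ℝ) [IsProbabilityMeasure μ]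
    (hmom : ∀ n : ℕ, ∫ t in Set.Icc (0:ℝ) 1, t ^ n ∂μ = fpSeq n) : μ {1} = 0 := by
  have hle : ∀ n : ℕ, μ.real {1} ^ 2 ≤ fpSeq n ^ 2 := by
    intro n
    refine pow_le_pow_left₀ measureReal_nonneg ?_ 2
    rw [← hmom n]
    have h : ∫ t in {(1:ℝ)}, t ^ n ∂μ = μ.real {1} := by
      rw [integral_singleton]; simp
    rw [← h]
    refine setIntegral_mono_set ((continuous_pow n).integrableOn_Icc) ?_
      (LE.le.eventuallyLE (by simp))
    exact (ae_restrict_iff' measurableSet_Icc).2 (.of_forall fun t ht => pow_nonneg ht.1 n)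
  have h2 := ge_of_tendsto' tendsto_fpSeq_sq hle
  have h3 : μ.real {1} = 0 := pow_eq_zero_iff two_ne_zero |>.1 (le_antisymm h2 (sq_nonneg _))
  exact (measureReal_eq_zero_iff).1 h3

theorem eq_withDensity_of_moments (μ : Measure ℝ) [IsProbabilityMeasure μ]
    (hsupp : μ (Set.Icc (0:ℝ) 1)ᶜ = 0)
    (hmom : ∀ n : ℕ, ∫ t in Set.Icc (0:ℝ) 1, t ^ n ∂μ = fpSeq n)
    {D : ℝ → ℝ} (hD : Measurable D) (h0 : ∀ t ∈ Ioo (0:ℝ) 1, 0 ≤ D t)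
    (hb : ∀ t ∈ Ioo (0:ℝ) 1, D t ≤ (1 - t)⁻¹)
    (hDmom : ∀ k : ℕ, ∫ t in Ioo (0:ℝ) 1, (1 - t) * D t * t ^ k = fpSeq k - fpSeq (k + 1)) :
    μ = (volume.restrict (Ioo (0:ℝ) 1)).withDensity fun t => ENNReal.ofReal (D t) := by
  have hae : ∀ᵐ t ∂μ, t ∈ Icc (0:ℝ) 1 := hsupp
  have hae1 : ∀ᵐ t ∂μ, t ≠ 1 := measure_eq_zero_iff_ae_notMem.1
    (measure_singleton_one_eq_zero_s17 μ hmom)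
  have hr : μ.restrict (Icc 0 1) = μ := Measure.restrict_eq_self_of_ae_mem hae
  rw [hr] at hmom
  have hpow : ∀ k : ℕ, Integrable (fun t : ℝ => t ^ k) μ := fun k =>
    hr ▸ (continuous_pow k).integrableOn_Icc (μ := μ)
  have hIoo : ∀ᵐ t ∂(volume.restrict (Ioo (0:ℝ) 1)), t ∈ Ioo (0:ℝ) 1 :=
    ae_restrict_mem measurableSet_Ioo
  have hD1 : ∀ t ∈ Ioo (0:ℝ) 1, (1 - t) * D t ≤ 1 := fun t ht => by
    have ht1 : 0 < 1 - t := sub_pos.2 ht.2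
    have := mul_le_mul_of_nonneg_left (hb t ht) ht1.le
    rwa [mul_inv_cancel₀ ht1.ne'] at this
  have key := withDensity_eq_of_moments (μ := μ) (ν := volume.restrict (Ioo (0:ℝ) 1))
    (w := fun t => 1 - t) (v := fun t => (1 - t) * D t) (by fun_prop) (by fun_prop)
    (((hpow 0).sub (hpow 1)).congr (.of_forall fun t => by simp))
    (hae.mono fun t ht => sub_nonneg.2 ht.2) hae
    ((integrable_const (1:ℝ)).mono' (by fun_prop) (hIoo.mono fun t ht => by
      rw [Real.norm_of_nonneg (mul_nonneg (sub_nonneg.2 ht.2.le) (h0 t ht))]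
      exact hD1 t ht))
    (hIoo.mono fun t ht => mul_nonneg (sub_nonneg.2 ht.2.le) (h0 t ht))
    (hIoo.mono fun t ht => Ioo_subset_Icc_self ht)
    (fun k => by
      rw [hDmom, ← hmom k, ← hmom (k + 1), ← integral_sub (hpow _) (hpow _)]
      exact integral_congr_ae (.of_forall fun t => by simp only; ring))
  have key2 := congrArg (fun ν : Measure ℝ =>
    ν.withDensity fun t => ENNReal.ofReal (1 - t)⁻¹) key
  rw [← withDensity_mul _ (by fun_prop) (by fun_prop),
    ← withDensity_mul _ (by fun_prop) (by fun_prop)] at key2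
  rw [withDensity_congr_ae (g := 1), withDensity_one] at key2
  · refine key2.trans (withDensity_congr_ae ?_)
    filter_upwards [hIoo] with t ht
    have ht1 : 0 < 1 - t := sub_pos.2 ht.2
    rw [Pi.mul_apply, ← ENNReal.ofReal_mul (mul_nonneg ht1.le (h0 t ht))]
    congr 1
    field_simp
  · filter_upwards [hae, hae1] with t ht ht'
    have ht1 : 0 < 1 - t := sub_pos.2 (lt_of_le_of_ne ht.2 ht')
    rw [Pi.mul_apply, ← ENNReal.ofReal_mul ht1.le, mul_inv_cancel₀ ht1.ne']
    simp

theorem integral_exp_neg_mul_rpow_mul_exp_neg_pow {s : ℝ} (hs : 0 < s) (k : ℕ) :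
    ∫ x in Ioi (0:ℝ), Real.exp (-x) * x ^ (s - 1) * Real.exp (-x) ^ k
      = (1 / ((k:ℝ) + 1)) ^ s * Real.Gamma s := by
  rw [← Real.integral_rpow_mul_exp_neg_mul_Ioi hs (by positivity : (0:ℝ) < k + 1)]
  refine integral_congr_ae (.of_forall fun x => ?_)
  simp only
  rw [mul_comm (Real.exp (-x)), mul_assoc, ← pow_succ', ← Real.exp_nat_mul]
  push_cast
  ring_nf

theorem ae_Ioi_exp_neg_mem_Icc :
    ∀ᵐ x ∂(volume.restrict (Ioi (0:ℝ))), Real.exp (-x) ∈ Icc (0:ℝ) 1 := by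
  filter_upwards [ae_restrict_mem measurableSet_Ioi] with x hx
  exact ⟨(Real.exp_pos _).le, Real.exp_le_one_iff.2 (by simpa using (mem_Ioi.1 hx).le)⟩

theorem ae_Ioo_pow_mem_Icc (n : ℕ) :
    ∀ᵐ t ∂(volume.restrict (Ioo (0:ℝ) 1)), t ^ n ∈ Icc (0:ℝ) 1 := by
  filter_upwards [ae_restrict_mem measurableSet_Ioo] with t ht
  exact ⟨pow_nonneg ht.1.le n, pow_le_one₀ ht.1.le ht.2.le⟩

theorem ae_Ioi_exp_neg_mul_rpow_nonneg (s : ℝ) :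
    ∀ᵐ x ∂(volume.restrict (Ioi (0:ℝ))), 0 ≤ Real.exp (-x) * x ^ (s - 1) := by
  filter_upwards [ae_restrict_mem measurableSet_Ioi] with x hx
  exact mul_nonneg (Real.exp_pos _).le (Real.rpow_nonneg (mem_Ioi.1 hx).le _)

theorem tendsto_mul_integral_pow_mul_comp_pow {g : ℝ → ℝ} (hg : Continuous g) :
    Tendsto (fun n : ℕ => ∫ t in Ioo (0:ℝ) 1, (n * t ^ n) * g (t ^ n)) atTop
      (nhds (∫ x in Ioi (0:ℝ), Real.exp (-x) * x ^ ((1:ℝ) - 1) * g (Real.exp (-x)))) := by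
  refine tendsto_integral_mul_comp_of_moments (fun n => ?_) (fun n => ?_) (fun n => by fun_prop)
    ae_Ioo_pow_mem_Icc (Real.GammaIntegral_convergent one_pos)
    (ae_Ioi_exp_neg_mul_rpow_nonneg 1) (by fun_prop) ae_Ioi_exp_neg_mem_Icc (fun k => ?_) hg
  · exact ((Continuous.integrableOn_Icc (a := 0) (b := 1) (by fun_prop)).mono_set
      Ioo_subset_Icc_self)
  · filter_upwards [ae_restrict_mem measurableSet_Ioo] with t ht
    have := ht.1
    positivity
  · rw [integral_exp_neg_mul_rpow_mul_exp_neg_pow one_pos, Real.rpow_one, Real.Gamma_one, mul_one]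
    have h : ∀ n : ℕ, ∫ t in Ioo (0:ℝ) 1, (n * t ^ n) * (t ^ n) ^ k
        = n / (n * ((k:ℝ) + 1) + 1) := by
      intro n
      have := setIntegral_Ioo_rpow (e := ((n * (k + 1) : ℕ) : ℝ)) (Nat.cast_nonneg _)
      simp only [Real.rpow_natCast] at this
      push_cast at this
      rw [div_eq_mul_one_div, ← this, ← integral_const_mul]
      exact integral_congr_ae (.of_forall fun t => by simp only; ring)
    simp only [h]
    have hlim : Tendsto (fun n : ℕ => 1 / ((k:ℝ) + 1 + (n:ℝ)⁻¹)) atTop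
        (nhds (1 / ((k:ℝ) + 1 + 0))) :=
      tendsto_const_nhds.div (tendsto_inv_atTop_nhds_zero_nat.const_add _) (by positivity)
    rw [add_zero] at hlim
    refine hlim.congr' ?_
    filter_upwards [eventually_gt_atTop 0] with n hn
    have : (0:ℝ) < n := by exact_mod_cast hn
    field_simp

section Tauberian

variable {D : ℝ → ℝ}

theorem tendsto_sqrt_mul_integral_pow_mul_comp_pow (hinteg : IntegrableOn D (Ioo 0 1))
    (h0 : ∀ t ∈ Ioo (0:ℝ) 1, 0 ≤ D t)
    (hlim : Tendsto (fun n : ℕ => Real.sqrt n * ∫ t in Ioo (0:ℝ) 1, D t * t ^ n) atTop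
      (nhds (Real.sqrt 2)⁻¹)) {g : ℝ → ℝ} (hg : Continuous g) :
    Tendsto (fun n : ℕ => ∫ t in Ioo (0:ℝ) 1, (Real.sqrt n * (D t * t ^ n)) * g (t ^ n)) atTop
      (nhds (∫ x in Ioi (0:ℝ), (Real.sqrt (2 * Real.pi))⁻¹ *
        (Real.exp (-x) * x ^ ((1 / 2 : ℝ) - 1)) * g (Real.exp (-x)))) := by
  refine tendsto_integral_mul_comp_of_moments (fun n => ?_) (fun n => ?_) (fun n => by fun_prop)
    ae_Ioo_pow_mem_Icc ((Real.GammaIntegral_convergent one_half_pos).const_mul _)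
    ?_ (by fun_prop) ae_Ioi_exp_neg_mem_Icc (fun k => ?_) hg
  · exact (integrable_mul_comp hinteg measurable_id (by simpa using ae_Ioo_pow_mem_Icc 1)
      (continuous_pow n)).const_mul _
  · filter_upwards [ae_restrict_mem measurableSet_Ioo] with t ht
    have := ht.1
    have := h0 t ht
    positivity
  · filter_upwards [ae_Ioi_exp_neg_mul_rpow_nonneg (1 / 2)] with x hx
    exact mul_nonneg (by positivity) hx
  · have e1 : ∫ x in Ioi (0:ℝ), (Real.sqrt (2 * Real.pi))⁻¹ *
        (Real.exp (-x) * x ^ ((1 / 2 : ℝ) - 1)) * Real.exp (-x) ^ k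
        = (Real.sqrt ((k:ℝ) + 1))⁻¹ * (Real.sqrt 2)⁻¹ := by
      simp only [mul_assoc (Real.sqrt (2 * Real.pi))⁻¹]
      rw [integral_const_mul, integral_exp_neg_mul_rpow_mul_exp_neg_pow one_half_pos,
        Real.Gamma_one_half_eq, ← Real.sqrt_eq_rpow, one_div, Real.sqrt_inv,
        Real.sqrt_mul zero_le_two]
      have : Real.sqrt Real.pi ≠ 0 := (Real.sqrt_pos.2 Real.pi_pos).ne'
      field_simp
    rw [e1]
    have hsub : Tendsto (fun n : ℕ => n * (k + 1)) atTop atTop :=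
      tendsto_id.atTop_mul_const' (Nat.succ_pos k)
    refine ((hlim.comp hsub).const_mul (Real.sqrt ((k:ℝ) + 1))⁻¹).congr fun n => ?_
    have hk : Real.sqrt ((k:ℝ) + 1) ≠ 0 := (Real.sqrt_pos.2 (by positivity)).ne'
    simp only [Function.comp_apply, mul_assoc (Real.sqrt (n:ℝ))]
    rw [integral_const_mul]
    push_cast
    rw [Real.sqrt_mul (Nat.cast_nonneg n)]
    have e2 : ∫ t in Ioo (0:ℝ) 1, D t * t ^ n * (t ^ n) ^ k
        = ∫ t in Ioo (0:ℝ) 1, D t * t ^ (n * (k + 1)) :=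
      integral_congr_ae (.of_forall fun t => by simp only; ring)
    rw [e2]
    field_simp

theorem exists_bump {a b : ℝ} (ha : 0 < a) (hab : a < b) :
    ∃ g : ℝ → ℝ, Continuous g ∧ (∀ y, 0 ≤ g y) ∧
      (∀ y, g y ≠ 0 → Real.exp (-b) < y ∧ y < Real.exp (-a)) ∧
      0 < ∫ x in Ioi (0:ℝ), Real.exp (-x) * x ^ ((1:ℝ) - 1) * g (Real.exp (-x)) := by
  have hexp : Real.exp (-b) < Real.exp (-a) := Real.exp_lt_exp.2 (by linarith)
  set g : ℝ → ℝ := fun y => max 0 ((y - Real.exp (-b)) * (Real.exp (-a) - y)) with hgdef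
  have hg : Continuous g := by fun_prop
  refine ⟨g, hg, fun y => le_max_left _ _, fun y hy => ?_, ?_⟩
  · have h : 0 < (y - Real.exp (-b)) * (Real.exp (-a) - y) := by
      by_contra! h
      exact hy (max_eq_left h)
    rcases mul_pos_iff.1 h with h | h <;> constructor <;> linarith [h.1, h.2]
  · have hnn : ∀ᵐ x ∂(volume.restrict (Ioi (0:ℝ))),
        0 ≤ Real.exp (-x) * x ^ ((1:ℝ) - 1) * g (Real.exp (-x)) := by
      filter_upwards [ae_Ioi_exp_neg_mul_rpow_nonneg 1] with x hx
      exact mul_nonneg hx (le_max_left _ _)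
    refine (setIntegral_pos_iff_support_of_nonneg_ae hnn (integrable_mul_comp
      (Real.GammaIntegral_convergent one_pos) (by fun_prop) ae_Ioi_exp_neg_mem_Icc hg)).2 ?_
    refine lt_of_lt_of_le (b := volume (Ioo a b)) (by simpa using hab) (measure_mono ?_)
    intro x hx
    refine ⟨?_, ha.trans hx.1⟩
    have h1 : Real.exp (-x) < Real.exp (-a) := Real.exp_lt_exp.2 (by linarith [hx.1])
    have h2 : Real.exp (-b) < Real.exp (-x) := Real.exp_lt_exp.2 (by linarith [hx.2])
    have h3 : 0 < g (Real.exp (-x)) :=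
      lt_max_of_lt_right (mul_pos (by linarith) (by linarith))
    simp only [Function.mem_support, sub_self, Real.rpow_zero, mul_one]
    positivity

theorem integral_bump_bounds {a b : ℝ} {g : ℝ → ℝ}
    (hg : Continuous g) (hg0 : ∀ y, 0 ≤ g y)
    (hsupp : ∀ y, g y ≠ 0 → Real.exp (-b) < y ∧ y < Real.exp (-a)) :
    (Real.sqrt (2 * Real.pi * a) * ∫ x in Ioi (0:ℝ), (Real.sqrt (2 * Real.pi))⁻¹ *
        (Real.exp (-x) * x ^ ((1 / 2 : ℝ) - 1)) * g (Real.exp (-x)))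
      ≤ ∫ x in Ioi (0:ℝ), Real.exp (-x) * x ^ ((1:ℝ) - 1) * g (Real.exp (-x)) ∧
    ∫ x in Ioi (0:ℝ), Real.exp (-x) * x ^ ((1:ℝ) - 1) * g (Real.exp (-x))
      ≤ (Real.sqrt (2 * Real.pi * b) * ∫ x in Ioi (0:ℝ), (Real.sqrt (2 * Real.pi))⁻¹ *
        (Real.exp (-x) * x ^ ((1 / 2 : ℝ) - 1)) * g (Real.exp (-x))) := by
  have hI := integrable_mul_comp
    ((Real.GammaIntegral_convergent one_half_pos).const_mul (Real.sqrt (2 * Real.pi))⁻¹)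
    (X := fun x : ℝ => Real.exp (-x)) (by fun_prop) ae_Ioi_exp_neg_mem_Icc hg
  have hJ := integrable_mul_comp (Real.GammaIntegral_convergent one_pos)
    (X := fun x : ℝ => Real.exp (-x)) (by fun_prop) ae_Ioi_exp_neg_mem_Icc hg
  have hπ : 0 < Real.sqrt (2 * Real.pi) := Real.sqrt_pos.2 (by positivity)
  have key : ∀ x ∈ Ioi (0:ℝ), ∀ c : ℝ, Real.sqrt (2 * Real.pi * c) *
      ((Real.sqrt (2 * Real.pi))⁻¹ * (Real.exp (-x) * x ^ ((1 / 2 : ℝ) - 1)) * g (Real.exp (-x)))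
      = Real.sqrt c / Real.sqrt x * (Real.exp (-x) * g (Real.exp (-x))) := by
    intro x hx c
    have : x ^ ((1 / 2 : ℝ) - 1) = (Real.sqrt x)⁻¹ := by
      rw [Real.sqrt_eq_rpow, ← Real.rpow_neg (mem_Ioi.1 hx).le]; norm_num
    rw [this, Real.sqrt_mul (by positivity)]
    field_simp
  have hx01 : ∀ x, g (Real.exp (-x)) ≠ 0 → a < x ∧ x < b := by
    intro x hx
    have h := hsupp _ hx
    rw [Real.exp_lt_exp, Real.exp_lt_exp] at h
    constructor <;> linarith [h.1, h.2]
  rw [← integral_const_mul, ← integral_const_mul]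
  constructor
  · refine setIntegral_mono_on (hI.const_mul _) hJ measurableSet_Ioi fun x hx => ?_
    rw [key x hx, sub_self, Real.rpow_zero, mul_one]
    by_cases h : g (Real.exp (-x)) = 0
    · simp [h]
    · refine mul_le_of_le_one_left (mul_nonneg (Real.exp_pos _).le (hg0 _)) ?_
      exact div_le_one_of_le₀ (Real.sqrt_le_sqrt (hx01 x h).1.le) (Real.sqrt_nonneg _)
  · refine setIntegral_mono_on hJ (hI.const_mul _) measurableSet_Ioi fun x hx => ?_
    rw [key x hx, sub_self, Real.rpow_zero, mul_one]
    by_cases h : g (Real.exp (-x)) = 0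
    · simp [h]
    · refine le_mul_of_one_le_left (mul_nonneg (Real.exp_pos _).le (hg0 _)) ?_
      rw [one_le_div (Real.sqrt_pos.2 hx)]
      exact Real.sqrt_le_sqrt (hx01 x h).2.le

theorem exp_neg_div_lt_iff {c t : ℝ} (ht : 0 < t) {n : ℕ} (hn : 0 < n) :
    Real.exp (-c / n) < t ↔ Real.exp (-c) < t ^ n := by
  have hn' : (0:ℝ) < n := by exact_mod_cast hn
  rw [← Real.lt_log_iff_exp_lt ht, ← Real.lt_log_iff_exp_lt (pow_pos ht n), Real.log_pow,
    div_lt_iff₀ hn', mul_comm]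

theorem lt_exp_neg_div_iff {c t : ℝ} (ht : 0 < t) {n : ℕ} (hn : 0 < n) :
    t < Real.exp (-c / n) ↔ t ^ n < Real.exp (-c) := by
  have hn' : (0:ℝ) < n := by exact_mod_cast hn
  rw [← Real.log_lt_iff_lt_exp ht, ← Real.log_lt_iff_lt_exp (pow_pos ht n), Real.log_pow,
    lt_div_iff₀ hn', mul_comm]

theorem exp_neg_div_mem_Ioo {c : ℝ} (hc : 0 < c) {n : ℕ} (hn : 0 < n) :
    Real.exp (-c / n) ∈ Ioo (0:ℝ) 1 := by
  have hn' : (0:ℝ) < n := by exact_mod_cast hn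
  refine ⟨Real.exp_pos _, Real.exp_lt_one_iff.2 ?_⟩
  rw [neg_div]
  exact neg_neg_of_pos (by positivity)

/-- Comparison of the two weighted integrals when `D` is bounded on the support of `g`. -/
theorem mul_integral_bump_le (hinteg : IntegrableOn D (Ioo 0 1))
    (hmono : MonotoneOn D (Ioo (0:ℝ) 1)) {a b : ℝ} (ha : 0 < a) (hab : a < b) {g : ℝ → ℝ}
    (hg : Continuous g) (hg0 : ∀ y, 0 ≤ g y)
    (hsupp : ∀ y, g y ≠ 0 → Real.exp (-b) < y ∧ y < Real.exp (-a)) {n : ℕ} (hn : 0 < n) :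
    D (Real.exp (-b / n)) * ∫ t in Ioo (0:ℝ) 1, (n * t ^ n) * g (t ^ n)
      ≤ Real.sqrt n * ∫ t in Ioo (0:ℝ) 1, (Real.sqrt n * (D t * t ^ n)) * g (t ^ n) ∧
    Real.sqrt n * ∫ t in Ioo (0:ℝ) 1, (Real.sqrt n * (D t * t ^ n)) * g (t ^ n)
      ≤ D (Real.exp (-a / n)) * ∫ t in Ioo (0:ℝ) 1, (n * t ^ n) * g (t ^ n) := by
  have hI : IntegrableOn (fun t => (Real.sqrt n * (D t * t ^ n)) * g (t ^ n)) (Ioo 0 1) :=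
    integrable_mul_comp ((integrable_mul_comp hinteg measurable_id
      (by simpa using ae_Ioo_pow_mem_Icc 1) (continuous_pow n)).const_mul _)
      (by fun_prop) (ae_Ioo_pow_mem_Icc n) hg
  have hJ : IntegrableOn (fun t : ℝ => (n * t ^ n) * g (t ^ n)) (Ioo 0 1) :=
    (Continuous.integrableOn_Icc (a := 0) (b := 1) (by fun_prop)).mono_set Ioo_subset_Icc_self
  have hs : Real.sqrt n * Real.sqrt n = n := Real.mul_self_sqrt (Nat.cast_nonneg n)
  have e : ∀ t, Real.sqrt n * ((Real.sqrt n * (D t * t ^ n)) * g (t ^ n))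
      = D t * ((n * t ^ n) * g (t ^ n)) := by
    intro t
    linear_combination (D t * t ^ n * g (t ^ n)) * hs
  rw [← integral_const_mul, ← integral_const_mul, ← integral_const_mul]
  constructor
  · refine setIntegral_mono_on (hJ.const_mul _) (hI.const_mul _) measurableSet_Ioo fun t ht => ?_
    rw [e]
    by_cases h : g (t ^ n) = 0
    · simp [h]
    · have h0 := ht.1
      refine mul_le_mul_of_nonneg_right ?_ (mul_nonneg (by positivity) (hg0 _))
      exact hmono (exp_neg_div_mem_Ioo (ha.trans hab) hn) ht
        ((exp_neg_div_lt_iff h0 hn).2 (hsupp _ h).1).le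
  · refine setIntegral_mono_on (hI.const_mul _) (hJ.const_mul _) measurableSet_Ioo fun t ht => ?_
    rw [e]
    by_cases h : g (t ^ n) = 0
    · simp [h]
    · have h0 := ht.1
      refine mul_le_mul_of_nonneg_right ?_ (mul_nonneg (by positivity) (hg0 _))
      exact hmono ht (exp_neg_div_mem_Ioo ha hn)
        ((lt_exp_neg_div_iff h0 hn).2 (hsupp _ h).2).le

theorem eventually_mul_sqrt_lt (hinteg : IntegrableOn D (Ioo 0 1))
    (h0 : ∀ t ∈ Ioo (0:ℝ) 1, 0 ≤ D t) (hmono : MonotoneOn D (Ioo (0:ℝ) 1))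
    (hlim : Tendsto (fun n : ℕ => Real.sqrt n * ∫ t in Ioo (0:ℝ) 1, D t * t ^ n) atTop
      (nhds (Real.sqrt 2)⁻¹)) {a b : ℝ} (ha : 0 < a) (hab : a < b) :
    ∀ᶠ n : ℕ in atTop, D (Real.exp (-b / n)) * Real.sqrt (2 * Real.pi * a) < Real.sqrt n := by
  obtain ⟨c, hac, hcb⟩ := exists_between hab
  obtain ⟨g, hg, hg0, hsupp, hpos⟩ := exists_bump (ha.trans hac) hcb
  have hI := tendsto_sqrt_mul_integral_pow_mul_comp_pow hinteg h0 hlim hg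
  have hJ := tendsto_mul_integral_pow_mul_comp_pow hg
  obtain ⟨hb1, hb2⟩ := integral_bump_bounds hg hg0 hsupp
  set I := ∫ x in Ioi (0:ℝ), (Real.sqrt (2 * Real.pi))⁻¹ *
    (Real.exp (-x) * x ^ ((1 / 2 : ℝ) - 1)) * g (Real.exp (-x))
  set J := ∫ x in Ioi (0:ℝ), Real.exp (-x) * x ^ ((1:ℝ) - 1) * g (Real.exp (-x))
  have hIpos : 0 < I := pos_of_mul_pos_right (hpos.trans_le hb2) (Real.sqrt_nonneg _)
  have hlt : Real.sqrt (2 * Real.pi * a) * I < J :=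
    lt_of_lt_of_le (mul_lt_mul_of_pos_right
      (Real.sqrt_lt_sqrt (by positivity) (by gcongr)) hIpos) hb1
  filter_upwards [(hI.const_mul (Real.sqrt (2 * Real.pi * a))).eventually_lt hJ hlt,
    hJ.eventually_const_lt hpos, eventually_gt_atTop 0] with n h1 h2 hn
  have h3 := (mul_integral_bump_le hinteg hmono (ha.trans hac) hcb hg hg0 hsupp hn).1
  have hsn : 0 < Real.sqrt n := Real.sqrt_pos.2 (by exact_mod_cast hn)
  have h4 := mul_le_mul_of_nonneg_right h3 (Real.sqrt_nonneg (2 * Real.pi * a))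
  have h5 := mul_lt_mul_of_pos_left h1 hsn
  refine lt_of_mul_lt_mul_right ?_ h2.le
  linarith

theorem eventually_sqrt_lt_mul (hinteg : IntegrableOn D (Ioo 0 1))
    (h0 : ∀ t ∈ Ioo (0:ℝ) 1, 0 ≤ D t) (hmono : MonotoneOn D (Ioo (0:ℝ) 1))
    (hlim : Tendsto (fun n : ℕ => Real.sqrt n * ∫ t in Ioo (0:ℝ) 1, D t * t ^ n) atTop
      (nhds (Real.sqrt 2)⁻¹)) {a b : ℝ} (ha : 0 < a) (hab : a < b) :
    ∀ᶠ n : ℕ in atTop, Real.sqrt n < D (Real.exp (-a / n)) * Real.sqrt (2 * Real.pi * b) := by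
  obtain ⟨c, hac, hcb⟩ := exists_between hab
  obtain ⟨g, hg, hg0, hsupp, hpos⟩ := exists_bump ha hac
  have hI := tendsto_sqrt_mul_integral_pow_mul_comp_pow hinteg h0 hlim hg
  have hJ := tendsto_mul_integral_pow_mul_comp_pow hg
  obtain ⟨-, hb2⟩ := integral_bump_bounds hg hg0 hsupp
  set I := ∫ x in Ioi (0:ℝ), (Real.sqrt (2 * Real.pi))⁻¹ *
    (Real.exp (-x) * x ^ ((1 / 2 : ℝ) - 1)) * g (Real.exp (-x))
  set J := ∫ x in Ioi (0:ℝ), Real.exp (-x) * x ^ ((1:ℝ) - 1) * g (Real.exp (-x))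
  have hIpos : 0 < I := pos_of_mul_pos_right (hpos.trans_le hb2) (Real.sqrt_nonneg _)
  have hlt : J < Real.sqrt (2 * Real.pi * b) * I :=
    lt_of_le_of_lt hb2 (mul_lt_mul_of_pos_right
      (Real.sqrt_lt_sqrt (by have := ha.trans hac; positivity) (by gcongr)) hIpos)
  filter_upwards [hJ.eventually_lt (hI.const_mul (Real.sqrt (2 * Real.pi * b))) hlt,
    hJ.eventually_const_lt hpos, eventually_gt_atTop 0] with n h1 h2 hn
  have h3 := (mul_integral_bump_le hinteg hmono ha hac hg hg0 hsupp hn).2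
  have hsn : 0 < Real.sqrt n := Real.sqrt_pos.2 (by exact_mod_cast hn)
  have h4 := mul_le_mul_of_nonneg_right h3 (Real.sqrt_nonneg (2 * Real.pi * b))
  have h5 := mul_lt_mul_of_pos_left h1 hsn
  refine lt_of_mul_lt_mul_right ?_ h2.le
  linarith

theorem tendsto_one_sub_div_neg_log :
    Tendsto (fun t : ℝ => (1 - t) / -Real.log t) (nhdsWithin 1 (Iio 1)) (nhds 1) := by
  have hev : ∀ᶠ t : ℝ in nhdsWithin 1 (Iio 1), t ∈ Ioo (0:ℝ) 1 :=
    Ioo_mem_nhdsLT one_pos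
  have hid : Tendsto (fun t : ℝ => t) (nhdsWithin 1 (Iio 1)) (nhds 1) :=
    tendsto_nhdsWithin_of_tendsto_nhds tendsto_id
  refine tendsto_of_tendsto_of_tendsto_of_le_of_le' hid tendsto_const_nhds ?_ ?_
  · filter_upwards [hev] with t ht
    have h1 := Real.one_sub_inv_le_log_of_pos ht.1
    have h2 := Real.log_neg ht.1 ht.2
    rw [le_div_iff₀ (by linarith)]
    have h3 := mul_le_mul_of_nonneg_left h1 ht.1.le
    rw [mul_sub, mul_inv_cancel₀ ht.1.ne'] at h3
    linarith
  · filter_upwards [hev] with t ht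
    have h1 := Real.log_le_sub_one_of_pos ht.1
    have h2 := Real.log_neg ht.1 ht.2
    exact div_le_one_of_le₀ (by linarith) (by linarith)

/-- A Tauberian theorem with monotone density. -/
theorem tendsto_mul_sqrt_of_monotoneOn (hinteg : IntegrableOn D (Ioo 0 1))
    (h0 : ∀ t ∈ Ioo (0:ℝ) 1, 0 ≤ D t) (hmono : MonotoneOn D (Ioo (0:ℝ) 1))
    (hlim : Tendsto (fun n : ℕ => Real.sqrt n * ∫ t in Ioo (0:ℝ) 1, D t * t ^ n) atTop
      (nhds (Real.sqrt 2)⁻¹)) :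
    Tendsto (fun t : ℝ => D t * Real.sqrt (2 * Real.pi * (1 - t)))
      (nhdsWithin 1 (Iio 1)) (nhds 1) := by
  have hev : ∀ᶠ t : ℝ in nhdsWithin 1 (Iio 1), t ∈ Ioo (0:ℝ) 1 :=
    Ioo_mem_nhdsLT one_pos
  have hid : Tendsto (fun t : ℝ => 1 - t) (nhdsWithin 1 (Iio 1)) (nhds 0) := by
    have : Tendsto (fun t : ℝ => 1 - t) (nhds 1) (nhds (1 - 1)) :=
      (continuous_const.sub continuous_id).tendsto 1
    rw [sub_self] at this
    exact tendsto_nhdsWithin_of_tendsto_nhds this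
  have hinv : Tendsto (fun t : ℝ => (-Real.log t)⁻¹) (nhdsWithin 1 (Iio 1)) atTop := by
    refine Tendsto.inv_tendsto_nhdsGT_zero (tendsto_nhdsWithin_iff.2 ⟨?_, ?_⟩)
    · have : Tendsto (fun t : ℝ => -Real.log t) (nhds 1) (nhds (-Real.log 1)) :=
        (Real.continuousAt_log one_ne_zero).neg
      rw [Real.log_one, neg_zero] at this
      exact tendsto_nhdsWithin_of_tendsto_nhds this
    · filter_upwards [hev] with t ht
      exact neg_pos.2 (Real.log_neg ht.1 ht.2)
  rw [tendsto_order]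
  constructor
  · intro l hl
    obtain ⟨r, hlr, hr1⟩ := exists_between (max_lt hl one_pos)
    have hr0 : 0 < r := (le_max_right _ _).trans_lt hlr
    have hlr' : l < r := (le_max_left _ _).trans_lt hlr
    have hN := (tendsto_nat_floor_atTop.comp hinv).eventually
      ((eventually_sqrt_lt_mul hinteg h0 hmono hlim one_pos (one_lt_inv_iff₀.2 ⟨hr0, hr1⟩)).and
        (eventually_gt_atTop 0))
    have hT : Tendsto (fun t : ℝ => Real.sqrt (r * ((1 - t) / -Real.log t - (1 - t))))
        (nhdsWithin 1 (Iio 1)) (nhds (Real.sqrt r)) := by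
      have := ((tendsto_one_sub_div_neg_log.sub hid).const_mul r).sqrt
      rwa [sub_zero, mul_one] at this
    have hrs : r < Real.sqrt r := by
      rw [Real.lt_sqrt hr0.le]; nlinarith
    filter_upwards [hN, hev, hT.eventually_const_lt hrs] with t ⟨h1, hn⟩ ht h2
    simp only [Function.comp_apply] at h1 hn
    set n := ⌊(-Real.log t)⁻¹⌋₊
    have hn' : (0:ℝ) < n := by exact_mod_cast hn
    have hx : 0 < -Real.log t := neg_pos.2 (Real.log_neg ht.1 ht.2)
    have ht1 : 0 < 1 - t := sub_pos.2 ht.2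
    have hle : (n:ℝ) ≤ (-Real.log t)⁻¹ := Nat.floor_le (by positivity)
    have hge : (-Real.log t)⁻¹ - 1 ≤ n := by linarith [Nat.lt_floor_add_one (-Real.log t)⁻¹]
    have hDle : D (Real.exp (-1 / n)) ≤ D t := by
      refine hmono (exp_neg_div_mem_Ioo one_pos hn) ht ?_
      rw [← Real.le_log_iff_exp_le ht.1, neg_div, neg_le, one_div]
      exact (le_inv_comm₀ hx hn').2 hle
    have h3 : Real.sqrt n < D t * Real.sqrt (2 * Real.pi * r⁻¹) :=
      h1.trans_le (mul_le_mul_of_nonneg_right hDle (Real.sqrt_nonneg _))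
    have h4 : Real.sqrt (r * ((1 - t) / -Real.log t - (1 - t)))
        ≤ Real.sqrt n * Real.sqrt (r * (1 - t)) := by
      rw [← Real.sqrt_mul (Nat.cast_nonneg n)]
      refine Real.sqrt_le_sqrt ?_
      have := mul_le_mul_of_nonneg_right hge (mul_pos hr0 ht1).le
      rw [div_eq_mul_inv]
      linarith
    have h5 := mul_lt_mul_of_pos_right h3 (Real.sqrt_pos.2 (mul_pos hr0 ht1))
    have h6 : D t * Real.sqrt (2 * Real.pi * r⁻¹) * Real.sqrt (r * (1 - t))
        = D t * Real.sqrt (2 * Real.pi * (1 - t)) := by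
      rw [mul_assoc, ← Real.sqrt_mul (by positivity)]
      congr 2
      field_simp
    linarith
  · intro u hu
    have hu0 : 0 < u := one_pos.trans hu
    have hN := (tendsto_nat_ceil_atTop.comp hinv).eventually
      ((eventually_mul_sqrt_lt hinteg h0 hmono hlim (inv_pos.2 hu0) (inv_lt_one_of_one_lt₀ hu)).and
        (eventually_gt_atTop 0))
    have hT : Tendsto (fun t : ℝ => Real.sqrt (u * ((1 - t) / -Real.log t + (1 - t))))
        (nhdsWithin 1 (Iio 1)) (nhds (Real.sqrt u)) := by
      have := ((tendsto_one_sub_div_neg_log.add hid).const_mul u).sqrt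
      rwa [add_zero, mul_one] at this
    have hus : Real.sqrt u < u := by
      rw [Real.sqrt_lt' hu0]; nlinarith
    filter_upwards [hN, hev, hT.eventually_lt_const hus] with t ⟨h1, hn⟩ ht h2
    simp only [Function.comp_apply] at h1 hn
    set n := ⌈(-Real.log t)⁻¹⌉₊
    have hn' : (0:ℝ) < n := by exact_mod_cast hn
    have hx : 0 < -Real.log t := neg_pos.2 (Real.log_neg ht.1 ht.2)
    have ht1 : 0 < 1 - t := sub_pos.2 ht.2
    have hge : (-Real.log t)⁻¹ ≤ n := Nat.le_ceil _
    have hle : (n:ℝ) ≤ (-Real.log t)⁻¹ + 1 :=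
      (Nat.ceil_lt_add_one (by positivity)).le
    have hDle : D t ≤ D (Real.exp (-1 / n)) := by
      refine hmono ht (exp_neg_div_mem_Ioo one_pos hn) ?_
      rw [← Real.log_le_iff_le_exp ht.1, neg_div, le_neg, one_div]
      exact (inv_le_comm₀ hx hn').1 hge
    have h3 : D t * Real.sqrt (2 * Real.pi * u⁻¹) < Real.sqrt n :=
      (mul_le_mul_of_nonneg_right hDle (Real.sqrt_nonneg _)).trans_lt h1
    have h4 : Real.sqrt n * Real.sqrt (u * (1 - t))
        ≤ Real.sqrt (u * ((1 - t) / -Real.log t + (1 - t))) := by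
      rw [← Real.sqrt_mul (Nat.cast_nonneg n)]
      refine Real.sqrt_le_sqrt ?_
      have := mul_le_mul_of_nonneg_right hle (mul_pos hu0 ht1).le
      rw [div_eq_mul_inv]
      linarith
    have h5 := mul_lt_mul_of_pos_right h3 (Real.sqrt_pos.2 (mul_pos hu0 ht1))
    have h6 : D t * Real.sqrt (2 * Real.pi * u⁻¹) * Real.sqrt (u * (1 - t))
        = D t * Real.sqrt (2 * Real.pi * (1 - t)) := by
      rw [mul_assoc, ← Real.sqrt_mul (by positivity)]
      congr 2
      field_simp
    linarith

end Tauberian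

theorem stmt_17 (μ : Measure ℝ) [IsProbabilityMeasure μ]
    (hsupp : μ (Set.Icc (0:ℝ) 1)ᶜ = 0) (h0 : μ {0} = 0)
    (hmom : ∀ n : ℕ, ∫ t in Set.Icc (0:ℝ) 1, t ^ n ∂μ = fpSeq n) :
    ∃ D : ℝ → ℝ,
      (∀ t ∈ Set.Ioo (0:ℝ) 1, 0 ≤ D t) ∧
      MonotoneOn D (Set.Ioo (0:ℝ) 1) ∧
      ConvexOn ℝ (Set.Ioo (0:ℝ) 1) D ∧
      μ = (MeasureTheory.volume.restrict (Set.Ioo (0:ℝ) 1)).withDensity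
            (fun t => ENNReal.ofReal (D t)) ∧
      Tendsto (fun t : ℝ => D t * Real.sqrt (2 * Real.pi * (1 - t)))
        (nhdsWithin 1 (Set.Iio 1)) (nhds 1) := by
  obtain ⟨D, hD, hD0, hmono, hconv, hb, hDmom⟩ := exists_convex_limit_density
  have hμ := eq_withDensity_of_moments μ hsupp hmom hD hD0 hb hDmom
  refine ⟨D, hD0, hmono, hconv, hμ, ?_⟩
  have hIoo : ∀ᵐ t ∂(volume.restrict (Ioo (0:ℝ) 1)), t ∈ Ioo (0:ℝ) 1 :=
    ae_restrict_mem measurableSet_Ioo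
  have hinteg : IntegrableOn D (Ioo 0 1) := by
    have hfin : ∫⁻ t in Ioo (0:ℝ) 1, ENNReal.ofReal (D t) ≠ ⊤ := by
      have h := measure_ne_top μ univ
      rw [hμ, withDensity_apply _ MeasurableSet.univ, Measure.restrict_univ] at h
      exact h
    exact (lintegral_ofReal_ne_top_iff_integrable hD.aestronglyMeasurable
      (hIoo.mono fun t ht => hD0 t ht)).1 hfin
  have hr : μ.restrict (Icc 0 1) = μ := Measure.restrict_eq_self_of_ae_mem hsupp
  have hDint : ∀ n : ℕ, ∫ t in Ioo (0:ℝ) 1, D t * t ^ n = fpSeq n := by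
    intro n
    rw [← hmom n, hr, hμ, integral_withDensity_eq_integral_toReal_smul hD.ennreal_ofReal (by simp)]
    refine integral_congr_ae (hIoo.mono fun t ht => ?_)
    simp only [ENNReal.toReal_ofReal (hD0 t ht), smul_eq_mul]
  refine tendsto_mul_sqrt_of_monotoneOn hinteg hD0 hmono ?_
  simpa only [hDint] using tendsto_sqrt_mul_fpSeq
end
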